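/- Let d ≥ 1, N ≥ 1 and 1 ≤ n ≤ N, and take the parameter κ = 0 ∈ ℝ^{d+1}. Then for all α, β ∈ Z_N^{d+1}, the Gram matrix of the vectors q_{α,n} = (Q_{α,n}(γ; 0, N))_{γ ∈ Z_N^{d+1}} is given by the reproducing kernel: Σ_{γ ∈ Z_N^{d+1}} Q_{α,n}(γ; 0, N) · Q_{β,n}(γ; 0, N) = (1 / C(N+d, d)) · Σ_{ν ∈ ℕ^d, |ν| = n} H_ν(α; 0, N) H_ν(β; 0, N) / B_ν(0, N). -/

import Mathlib

open Finset

/-- Pochhammer symbol `(a)_k = a (a+1) ⋯ (a+k-1)`. -/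
noncomputable def poch (a : ℝ) : ℕ → ℝ
  | 0 => 1
  | k + 1 => poch a k * (a + k)

/-- Multi-index Pochhammer `(x)_γ = ∏ i (x i)_{γ i}`. -/
noncomputable def pochV {m : ℕ} (x : Fin m → ℝ) (γ : Fin m → ℕ) : ℝ :=
  ∏ i, poch (x i) (γ i)

/-- Multi-index factorial `γ! = ∏ i (γ i)!` (as a real number). -/
noncomputable def mfact {m : ℕ} (γ : Fin m → ℕ) : ℝ :=
  ∏ i, (Nat.factorial (γ i) : ℝ)

/-- Shifted monomial `m_γ(x) = (-1)^{|γ|} (-x)_γ`. -/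
noncomputable def mono {m : ℕ} (γ : Fin m → ℕ) (x : Fin m → ℝ) : ℝ :=
  (-1 : ℝ) ^ (∑ i, γ i) * pochV (fun i => -(x i)) γ

/-- `Z_N^{d+1} = {α ∈ ℕ^{d+1} : |α| = N}` as a finite set. -/
def ZN (d N : ℕ) : Finset (Fin (d + 1) → ℕ) :=
  (Fintype.piFinset fun _ => Finset.range (N + 1)).filter fun α => ∑ i, α i = N

/-- `{ν ∈ ℕ^d : |ν| = n}` as a finite set. -/
def idxSet (d n : ℕ) : Finset (Fin d → ℕ) :=
  (Fintype.piFinset fun _ => Finset.range (n + 1)).filter fun ν => ∑ i, ν i = n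

/-- The finite set `{γ ∈ ℕ^m : γ ≤ α}`. -/
def below {m : ℕ} (α : Fin m → ℕ) : Finset (Fin m → ℕ) :=
  Fintype.piFinset fun i => Finset.range (α i + 1)

/-- Monic Hahn polynomial `Q_α(x; κ, N)`. -/
noncomputable def monicQ (d N : ℕ) (κ : Fin (d + 1) → ℝ) (α : Fin (d + 1) → ℕ)
    (x : Fin (d + 1) → ℝ) : ℝ :=
  poch (-(N : ℝ)) (∑ i, α i) * pochV (fun i => κ i + 1) α /
      poch ((∑ i, κ i) + d + (∑ i, α i)) (∑ i, α i) *
    ∑ γ ∈ below α,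
      pochV (fun i => -(α i : ℝ)) γ * poch ((∑ i, κ i) + d + (∑ i, α i)) (∑ i, γ i) *
          (-1 : ℝ) ^ (∑ i, γ i) /
          (mfact γ * pochV (fun i => κ i + 1) γ * poch (-(N : ℝ)) (∑ i, γ i)) *
        mono γ x

/-- One-variable Hahn polynomial `Q_n(x; a, b, M)` (a `₃F₂` sum). -/
noncomputable def hahn1 (n : ℕ) (x a b M : ℝ) : ℝ :=
  ∑ k ∈ Finset.range (n + 1),
    poch (-(n : ℝ)) k * poch ((n : ℝ) + a + b + 1) k * poch (-x) k /
      (poch (a + 1) k * poch (-M) k * (Nat.factorial k : ℝ))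

/-- The parameter `a_j = κ_{j+1}+⋯+κ_{d+1} + 2|ν^{j+1}| + d - j` (1-based `j`). -/
noncomputable def aj (d : ℕ) (κ : Fin (d + 1) → ℝ) (ν : Fin d → ℕ) (j : Fin d) : ℝ :=
  (∑ i ∈ Finset.univ.filter (fun i : Fin (d + 1) => (j : ℕ) < (i : ℕ)), κ i) +
    2 * (∑ i ∈ Finset.univ.filter (fun i : Fin d => (j : ℕ) < (i : ℕ)), (ν i : ℝ)) +
    ((d - 1 - (j : ℕ) : ℕ) : ℝ)

/-- `|x_{j-1}| = x_1 + ⋯ + x_{j-1}` (1-based `j`). -/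
noncomputable def sumLt (d : ℕ) (x : Fin (d + 1) → ℕ) (j : Fin d) : ℝ :=
  ∑ i ∈ Finset.univ.filter (fun i : Fin (d + 1) => (i : ℕ) < (j : ℕ)), (x i : ℝ)

/-- `|ν^{j+1}| = ν_{j+1} + ⋯ + ν_d` (1-based `j`). -/
noncomputable def sumGt (d : ℕ) (ν : Fin d → ℕ) (j : Fin d) : ℝ :=
  ∑ i ∈ Finset.univ.filter (fun i : Fin d => (j : ℕ) < (i : ℕ)), (ν i : ℝ)

/-- Hahn polynomial of `d` variables `H_ν(x; κ, N)`. -/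
noncomputable def hahnH (d N : ℕ) (κ : Fin (d + 1) → ℝ) (ν : Fin d → ℕ)
    (x : Fin (d + 1) → ℕ) : ℝ :=
  (-1 : ℝ) ^ (∑ i, ν i) / poch (-(N : ℝ)) (∑ i, ν i) *
    ∏ j : Fin d,
      poch (κ j.castSucc + 1) (ν j) / poch (aj d κ ν j + 1) (ν j) *
        poch (-(N : ℝ) + sumLt d x j + sumGt d ν j) (ν j) *
        hahn1 (ν j) (x j.castSucc : ℝ) (κ j.castSucc) (aj d κ ν j)
          ((N : ℝ) - sumLt d x j - sumGt d ν j)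

/-- Squared norm `B_ν(κ, N)` of the Hahn polynomial `H_ν(·; κ, N)`. -/
noncomputable def Bnorm (d N : ℕ) (κ : Fin (d + 1) → ℝ) (ν : Fin d → ℕ) : ℝ :=
  (-1 : ℝ) ^ (∑ i, ν i) * poch ((∑ i, κ i) + d + 1) (N + ∑ i, ν i) /
      (poch (-(N : ℝ)) (∑ i, ν i) * poch ((∑ i, κ i) + d + 1) N *
        poch ((∑ i, κ i) + d + 1) (2 * ∑ i, ν i)) *
    ∏ j : Fin d,
      poch (κ j.castSucc + aj d κ ν j + 1) (2 * ν j) * poch (κ j.castSucc + 1) (ν j) *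
          (Nat.factorial (ν j) : ℝ) /
        (poch (κ j.castSucc + aj d κ ν j + 1) (ν j) * poch (aj d κ ν j + 1) (ν j))

/-- Projection `Q_{α,n}(x; κ, N)` of `m_α/(κ+1)_α` onto the space of degree `n`. -/
noncomputable def monicQn (d N : ℕ) (κ : Fin (d + 1) → ℝ) (α : Fin (d + 1) → ℕ) (n : ℕ)
    (x : Fin (d + 1) → ℝ) : ℝ :=
  (-1 : ℝ) ^ (∑ i, α i) * poch (-(N : ℝ)) (∑ i, α i) * poch ((∑ i, κ i) + d + 1) (2 * n) /
      (poch (-(N : ℝ)) n * poch ((∑ i, κ i) + d + 1) ((∑ i, α i) + n)) *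
    ∑ β ∈ ZN d n,
      pochV (fun i => -(α i : ℝ)) β / (mfact β * pochV (fun i => κ i + 1) β) *
        monicQ d N κ β x

/-- The kernel `E_k(x, y; κ) = Σ_{|γ|=k} (-x)_γ (-y)_γ / (γ! (κ+1)_γ)`. -/
noncomputable def Efun (d : ℕ) (κ : Fin (d + 1) → ℝ) (x y : Fin (d + 1) → ℕ) (k : ℕ) : ℝ :=
  ∑ γ ∈ ZN d k,
    pochV (fun i => -(x i : ℝ)) γ * pochV (fun i => -(y i : ℝ)) γ /
      (mfact γ * pochV (fun i => κ i + 1) γ)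

/-- Monic Jacobi polynomial on the simplex `R_α^κ(x)`. -/
noncomputable def jacobiR (d : ℕ) (κ : Fin (d + 1) → ℝ) (α : Fin (d + 1) → ℕ)
    (x : Fin d → ℝ) : ℝ :=
  (-1 : ℝ) ^ (∑ i, α i) * pochV (fun i => κ i + 1) α /
      poch ((∑ i, κ i) + d + (∑ i, α i)) (∑ i, α i) *
    ∑ γ ∈ below α,
      pochV (fun i => -(α i : ℝ)) γ * poch ((∑ i, κ i) + d + (∑ i, α i)) (∑ i, γ i) /
          (pochV (fun i => κ i + 1) γ * mfact γ) *
        ∏ i, (Fin.snoc x (1 - ∑ i, x i) : Fin (d + 1) → ℝ) i ^ γ i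

/-- One-variable Krawtchouk polynomial `K_n(x; p, M)`. -/
noncomputable def kraw1 (n : ℕ) (x p M : ℝ) : ℝ :=
  ∑ k ∈ Finset.range (n + 1),
    poch (-(n : ℝ)) k * poch (-x) k / (poch (-M) k * (Nat.factorial k : ℝ) * p ^ k)

/-- The extended parameter `𝛒 = (ρ_1, …, ρ_d, 1 - |ρ|)`. -/
noncomputable def brho (d : ℕ) (ρ : Fin d → ℝ) : Fin (d + 1) → ℝ :=
  Fin.snoc ρ (1 - ∑ i, ρ i)

/-- `𝛒^γ = ∏ i 𝛒_i^{γ i}`. -/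
noncomputable def bpow (d : ℕ) (ρ : Fin d → ℝ) (γ : Fin (d + 1) → ℕ) : ℝ :=
  ∏ i, brho d ρ i ^ γ i

/-- `|𝛒_j| = ρ_1 + ⋯ + ρ_j` (1-based `j`). -/
noncomputable def sumLe (d : ℕ) (ρ : Fin d → ℝ) (j : Fin d) : ℝ :=
  ∑ i ∈ Finset.univ.filter (fun i : Fin d => (i : ℕ) ≤ (j : ℕ)), ρ i

/-- `|𝛒_{j-1}| = ρ_1 + ⋯ + ρ_{j-1}` (1-based `j`). -/
noncomputable def sumLtρ (d : ℕ) (ρ : Fin d → ℝ) (j : Fin d) : ℝ :=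
  ∑ i ∈ Finset.univ.filter (fun i : Fin d => (i : ℕ) < (j : ℕ)), ρ i

/-- Krawtchouk polynomial of `d` variables `K_ν(x; ρ, N)`. -/
noncomputable def krawH (d N : ℕ) (ρ : Fin d → ℝ) (ν : Fin d → ℕ)
    (x : Fin (d + 1) → ℕ) : ℝ :=
  (-1 : ℝ) ^ (∑ i, ν i) / poch (-(N : ℝ)) (∑ i, ν i) *
    ∏ j : Fin d,
      ρ j ^ ν j / (1 - sumLe d ρ j) ^ ν j *
        poch (-(N : ℝ) + sumLt d x j + sumGt d ν j) (ν j) *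
        kraw1 (ν j) (x j.castSucc : ℝ) (ρ j / (1 - sumLtρ d ρ j))
          ((N : ℝ) - sumLt d x j - sumGt d ν j)

/-- Squared norm `C_ν(ρ, N)` of the Krawtchouk polynomial `K_ν(·; ρ, N)`. -/
noncomputable def Cnorm (d N : ℕ) (ρ : Fin d → ℝ) (ν : Fin d → ℕ) : ℝ :=
  (-1 : ℝ) ^ (∑ i, ν i) / (poch (-(N : ℝ)) (∑ i, ν i) * (Nat.factorial N : ℝ)) *
    ∏ j : Fin d,
      (Nat.factorial (ν j) : ℝ) * ρ j ^ ν j /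
        (1 - sumLe d ρ j) ^ ((ν j : ℤ) - ((Fin.snoc ν 0 : Fin (d + 1) → ℕ) j.succ : ℤ))

/-- Monic Krawtchouk polynomial `L_α(x; ρ, N)`. -/
noncomputable def monicL (d N : ℕ) (ρ : Fin d → ℝ) (α : Fin (d + 1) → ℕ)
    (x : Fin (d + 1) → ℝ) : ℝ :=
  poch (-(N : ℝ)) (∑ i, α i) * bpow d ρ α *
    ∑ γ ∈ below α,
      pochV (fun i => -(α i : ℝ)) γ * (-1 : ℝ) ^ (∑ i, γ i) /
          (mfact γ * poch (-(N : ℝ)) (∑ i, γ i) * bpow d ρ γ) *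
        mono γ x

/-- Projection `L_{α,n}(x; ρ, N)` of `m_α/𝛒^α` onto the space of degree `n`. -/
noncomputable def monicLn (d N : ℕ) (ρ : Fin d → ℝ) (α : Fin (d + 1) → ℕ) (n : ℕ)
    (x : Fin (d + 1) → ℝ) : ℝ :=
  (-1 : ℝ) ^ (∑ i, α i) * poch (-(N : ℝ)) (∑ i, α i) / poch (-(N : ℝ)) n *
    ∑ β ∈ ZN d n,
      pochV (fun i => -(α i : ℝ)) β / (mfact β * bpow d ρ β) * monicL d N ρ β x

/-- The kernel `F_k(x, y; ρ) = Σ_{|γ|=k} (-x)_γ (-y)_γ / (γ! 𝛒^γ)`. -/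
noncomputable def Ffun (d : ℕ) (ρ : Fin d → ℝ) (x y : Fin (d + 1) → ℕ) (k : ℕ) : ℝ :=
  ∑ γ ∈ ZN d k,
    pochV (fun i => -(x i : ℝ)) γ * pochV (fun i => -(y i : ℝ)) γ / (mfact γ * bpow d ρ γ)


/-! ### Binomial identities over `ℝ` -/

theorem choose_succ_mul_cast (x k : ℕ) :
    (x.choose (k + 1) : ℝ) * (k + 1) = x.choose k * (x - k) := by
  rcases le_or_gt k x with h | h
  · have := Nat.choose_succ_right_eq x k
    have h2 : ((x - k : ℕ) : ℝ) = x - k := by push_cast [h]; ring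
    rw [← h2]
    exact_mod_cast this
  · simp [Nat.choose_eq_zero_of_lt h, Nat.choose_eq_zero_of_lt (Nat.lt_succ_of_lt h)]

theorem succ_mul_choose_cast (x k : ℕ) :
    ((x : ℝ) + 1) * x.choose k = (x + 1 - k) * (x + 1).choose k := by
  have h1 : ((x + 1 : ℕ) : ℝ) * x.choose k = ((x + 1).choose (k + 1) : ℝ) * (k + 1) := by
    exact_mod_cast Nat.add_one_mul_choose_eq x k
  have h2 := choose_succ_mul_cast (x + 1) k
  push_cast at h1 h2
  linarith

theorem mul_choose_pred_cast (x k : ℕ) :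
    (x : ℝ) * (x - 1).choose k = (x - k) * x.choose k := by
  cases x with
  | zero => cases k <;> simp
  | succ x => simpa using succ_mul_choose_cast x k

theorem succ_mul_choose_succ_cast (x k : ℕ) :
    ((x : ℝ) + 1) * (x + 1).choose (k + 1) =
      (x + 1 + (k + 1)) * x.choose (k + 1) + (k + 1) * x.choose k := by
  have h := choose_succ_mul_cast x k
  rw [Nat.choose_succ_succ]
  push_cast
  linarith

/-- Recurrence for alternating binomial sums in the order of the difference. -/
theorem sum_alternating_choose_succ (r : ℕ) (f : ℕ → ℝ) :
    ∑ i ∈ range (r + 2), (-1 : ℝ) ^ i * (r + 1).choose i * f i =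
      ∑ i ∈ range (r + 1), (-1 : ℝ) ^ i * r.choose i * (f i - f (i + 1)) := by
  have h : ∑ i ∈ range (r + 1), (-1 : ℝ) ^ i * r.choose i * f i =
      ∑ i ∈ range (r + 1), (-1 : ℝ) ^ (i + 1) * r.choose (i + 1) * f (i + 1) + f 0 := by
    have := sum_range_succ' (fun i => (-1 : ℝ) ^ i * r.choose i * f i) (r + 1)
    rw [sum_range_succ, Nat.choose_succ_self] at this
    simpa using this
  rw [sum_range_succ']
  simp only [mul_sub, sum_sub_distrib, Nat.choose_succ_succ]
  rw [h, add_sub_right_comm, ← sum_sub_distrib]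
  simp only [pow_zero, Nat.choose_zero_right, Nat.cast_one, one_mul]
  congr 1
  refine sum_congr rfl fun i _ => ?_
  push_cast
  ring

/-- The `r`-th difference of a binomial coefficient of lower degree vanishes. -/
theorem sum_alternating_choose_eq_zero (r s c : ℕ) (h : s < r) :
    ∑ i ∈ range (r + 1), (-1 : ℝ) ^ i * r.choose i * (c + i).choose s = 0 := by
  induction r generalizing s with
  | zero => omega
  | succ r ih =>
    rw [sum_alternating_choose_succ]
    cases s with
    | zero => simp
    | succ s =>
      rw [← neg_eq_zero, ← ih s (by omega), ← sum_neg_distrib]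
      refine sum_congr rfl fun i _ => ?_
      rw [← add_assoc c i 1, Nat.choose_succ_succ]
      push_cast
      ring

theorem sum_alternating_choose_add (r t c : ℕ) :
    ∑ i ∈ range (r + 1), (-1 : ℝ) ^ i * r.choose i * (c + i).choose (r + t) =
      (-1) ^ r * c.choose t := by
  induction r with
  | zero => simp
  | succ r ih =>
    rw [sum_alternating_choose_succ, pow_succ, mul_neg_one, neg_mul, ← ih, ← sum_neg_distrib]
    refine sum_congr rfl fun i _ => ?_
    rw [← add_assoc c i 1, show r + 1 + t = r + t + 1 by ring, Nat.choose_succ_succ (c + i)]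
    push_cast
    ring

theorem sum_antidiagonal_alternating_choose (r m : ℕ) (h : r ≤ m) :
    ∑ q ∈ antidiagonal r, (-1 : ℝ) ^ q.1 * (m + q.1).choose q.1 * r.choose q.1 =
      (-1) ^ r * m.choose r := by
  obtain ⟨t, rfl⟩ := Nat.exists_eq_add_of_le h
  rw [Nat.sum_antidiagonal_eq_sum_range_succ_mk, Nat.choose_symm_add,
    ← sum_alternating_choose_add r t (r + t)]
  refine sum_congr rfl fun i _ => ?_
  dsimp only
  rw [Nat.choose_symm_add]
  ring

theorem sum_antidiagonal_assoc (n : ℕ) (f : ℕ → ℕ → ℕ → ℝ) :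
    ∑ p ∈ antidiagonal n, ∑ q ∈ antidiagonal p.2, f p.1 q.1 q.2 =
      ∑ p ∈ antidiagonal n, ∑ q ∈ antidiagonal p.1, f q.1 q.2 p.2 := by
  rw [sum_sigma', sum_sigma']
  refine sum_nbij' (fun z => ⟨(z.1.1 + z.2.1, z.2.2), (z.1.1, z.2.1)⟩)
    (fun z => ⟨(z.2.1, z.2.2 + z.1.2), (z.2.2, z.1.2)⟩) ?_ ?_ ?_ ?_ ?_
  · rintro ⟨⟨a, b⟩, ⟨c, e⟩⟩ h
    simp only [mem_sigma, HasAntidiagonal.mem_antidiagonal] at h ⊢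
    exact ⟨by omega, trivial⟩
  · rintro ⟨⟨a, b⟩, ⟨c, e⟩⟩ h
    simp only [mem_sigma, HasAntidiagonal.mem_antidiagonal] at h ⊢
    exact ⟨by omega, trivial⟩
  · rintro ⟨⟨a, b⟩, ⟨c, e⟩⟩ h
    simp only [mem_sigma, HasAntidiagonal.mem_antidiagonal] at h
    obtain ⟨-, rfl⟩ := h
    rfl
  · rintro ⟨⟨a, b⟩, ⟨c, e⟩⟩ h
    simp only [mem_sigma, HasAntidiagonal.mem_antidiagonal] at h
    obtain ⟨-, rfl⟩ := h
    rfl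
  · rintro ⟨⟨a, b⟩, ⟨c, e⟩⟩ h
    rfl

/-! ### Pochhammer symbols at integers -/

theorem poch_neg_natCast (x k : ℕ) :
    poch (-(x : ℝ)) k = (-1) ^ k * k.factorial * x.choose k := by
  induction k with
  | zero => simp [poch]
  | succ k ih =>
    have := choose_succ_mul_cast x k
    rw [poch, ih, Nat.factorial_succ]
    push_cast
    linear_combination (-1 : ℝ) ^ k * k.factorial * this

theorem poch_natCast_add_one (a k : ℕ) :
    poch ((a : ℝ) + 1) k = (a + k).factorial / a.factorial := by
  rw [eq_div_iff (by positivity)]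
  induction k with
  | zero => simp [poch]
  | succ k ih =>
    rw [poch, ← add_assoc, Nat.factorial_succ]
    push_cast
    linear_combination ((a : ℝ) + 1 + k) * ih

theorem poch_natCast_add_one_pos (a k : ℕ) : 0 < poch ((a : ℝ) + 1) k := by
  rw [poch_natCast_add_one]
  positivity

theorem poch_one (k : ℕ) : poch 1 k = k.factorial := by
  simpa using poch_natCast_add_one 0 k

/-! ### The one-variable Hahn polynomial with first parameter `0` -/

/-- The Hahn polynomial of degree `n` with parameters `0`, `a` on `x + y = M`, normalized to be
homogeneous: it equals `(-M)_n Q_n(x; 0, a, M)` up to the factor `(-1)^n n!`. -/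
noncomputable def hahnCore (n a x y : ℕ) : ℝ :=
  ∑ p ∈ antidiagonal n, (-1 : ℝ) ^ p.1 * (n + a).choose p.1 * (x.choose p.1 * y.choose p.2)

theorem hahnCore_eq_zero {n x y : ℕ} (a : ℕ) (h : x + y < n) : hahnCore n a x y = 0 := by
  refine sum_eq_zero fun p hp => ?_
  rw [HasAntidiagonal.mem_antidiagonal] at hp
  rcases lt_or_ge x p.1 with h1 | h1
  · simp [Nat.choose_eq_zero_of_lt h1]
  · simp [Nat.choose_eq_zero_of_lt (show y < p.2 by omega)]

theorem hahnCore_of_add_eq (a x y : ℕ) :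
    hahnCore (x + y) a x y = (-1) ^ x * (x + y + a).choose x := by
  rw [hahnCore, sum_eq_single (x, y)]
  · simp
  · rintro ⟨i, j⟩ hp hne
    rw [HasAntidiagonal.mem_antidiagonal] at hp
    rcases lt_or_ge x i with h1 | h1
    · simp [Nat.choose_eq_zero_of_lt h1]
    · have : y < j := by
        by_contra h2
        exact hne (by ext <;> simp <;> omega)
      simp [Nat.choose_eq_zero_of_lt this]
  · simp

theorem hahnCore_raise (n a x y : ℕ) :
    x * hahnCore n a (x - 1) y + y * hahnCore n a x (y - 1) =
      (x + y - n) * hahnCore n a x y := by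
  simp only [hahnCore, mul_sum, ← sum_add_distrib]
  refine sum_congr rfl fun p hp => ?_
  rw [HasAntidiagonal.mem_antidiagonal] at hp
  have h1 := mul_choose_pred_cast x p.1
  have h2 := mul_choose_pred_cast y p.2
  have h3 : (n : ℝ) = p.1 + p.2 := by rw [← hp]; push_cast; ring
  rw [h3]
  linear_combination (-1 : ℝ) ^ p.1 * (n + a).choose p.1 * y.choose p.2 * h1 +
    (-1 : ℝ) ^ p.1 * (n + a).choose p.1 * x.choose p.1 * h2

theorem hahnCore_lower (n a x y : ℕ) :
    (x + 1) * hahnCore n a (x + 1) y + (y + 1 + a) * hahnCore n a x (y + 1) =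
      (x + y + n + a + 2) * hahnCore n a x y := by
  have hx : ∀ k, ((x : ℝ) + 1) * (x + 1).choose k =
      (x + 1 + k) * x.choose k + k * x.choose (k - 1) := by
    rintro (_ | k)
    · simp
    · simpa using succ_mul_choose_succ_cast x k
  have hy : ∀ k, ((y : ℝ) + 1 + a) * (y + 1).choose k =
      (y + 1 + k + a) * y.choose k + (k + a) * (if k = 0 then 0 else y.choose (k - 1)) := by
    rintro (_ | k)
    · simp
    · have := succ_mul_choose_succ_cast y k
      rw [add_mul, this, Nat.choose_succ_succ]
      simp
      ring
  have key : ∑ p ∈ antidiagonal n, (-1 : ℝ) ^ p.1 * (n + a).choose p.1 *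
        (p.1 * x.choose (p.1 - 1)) * y.choose p.2 +
      ∑ p ∈ antidiagonal n, (-1 : ℝ) ^ p.1 * (n + a).choose p.1 * x.choose p.1 *
        ((p.2 + a) * (if p.2 = 0 then 0 else y.choose (p.2 - 1))) = 0 := by
    cases n with
    | zero => simp
    | succ n =>
      rw [Nat.sum_antidiagonal_succ, Nat.sum_antidiagonal_succ']
      simp only [Nat.cast_zero, zero_mul, mul_zero, zero_add, if_true,
        Nat.add_sub_cancel, Nat.succ_ne_zero, if_false, ← sum_add_distrib]
      refine sum_eq_zero fun p hp => ?_
      rw [HasAntidiagonal.mem_antidiagonal] at hp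
      have h := choose_succ_mul_cast (n + 1 + a) p.1
      have h3 : (n : ℝ) = p.1 + p.2 := by rw [← hp]; push_cast; ring
      push_cast at h ⊢
      rw [h3] at h
      linear_combination -(-1 : ℝ) ^ p.1 * x.choose p.1 * y.choose p.2 * h
  rw [← add_zero ((_ : ℝ) * hahnCore n a x y), ← key]
  simp only [hahnCore, mul_sum, ← sum_add_distrib]
  refine sum_congr rfl fun p hp => ?_
  rw [HasAntidiagonal.mem_antidiagonal] at hp
  have h3 : (n : ℝ) = p.1 + p.2 := by rw [← hp]; push_cast; ring
  rw [h3]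
  linear_combination (-1 : ℝ) ^ p.1 * (n + a).choose p.1 * y.choose p.2 * hx p.1 +
    (-1 : ℝ) ^ p.1 * (n + a).choose p.1 * x.choose p.1 * hy p.2

/-- The transformation of the `₃F₂` sum into the homogeneous form. -/
theorem sum_hahn_eq_hahnCore (n a x y : ℕ) :
    ∑ p ∈ antidiagonal n, (-1 : ℝ) ^ p.1 * (n + a + p.1).choose p.1 *
        (x.choose p.1 * (x + y - p.1).choose p.2) = hahnCore n a x y := by
  have h : ∀ k i : ℕ, (x.choose k * (x - k).choose i : ℝ) =
      x.choose (k + i) * (k + i).choose k := by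
    intro k i
    have := Nat.choose_mul (n := x) (Nat.le_add_right k i)
    rw [Nat.add_sub_cancel_left] at this
    exact_mod_cast this.symm
  calc _ = ∑ p ∈ antidiagonal n, ∑ q ∈ antidiagonal p.2,
        (-1 : ℝ) ^ p.1 * (n + a + p.1).choose p.1 *
          (x.choose (p.1 + q.1) * (p.1 + q.1).choose p.1) * y.choose q.2 := by
        refine sum_congr rfl fun p _ => ?_
        rcases lt_or_ge x p.1 with h1 | h1
        · rw [Nat.choose_eq_zero_of_lt h1]
          simp only [Nat.cast_zero, zero_mul, mul_zero]
          refine (sum_eq_zero (M := ℝ) fun q _ => ?_).symm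
          rw [← h, Nat.choose_eq_zero_of_lt h1]
          simp
        · rw [show x + y - p.1 = (x - p.1) + y by omega, Nat.add_choose_eq (x - p.1) y p.2]
          push_cast
          rw [mul_sum, mul_sum]
          refine sum_congr rfl fun q _ => ?_
          rw [← h]
          ring
    _ = ∑ p ∈ antidiagonal n, ∑ q ∈ antidiagonal p.1,
        (-1 : ℝ) ^ q.1 * (n + a + q.1).choose q.1 *
          (x.choose (q.1 + q.2) * (q.1 + q.2).choose q.1) * y.choose p.2 :=
        sum_antidiagonal_assoc n fun k i j => (-1 : ℝ) ^ k * (n + a + k).choose k *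
          (x.choose (k + i) * (k + i).choose k) * y.choose j
    _ = _ := by
        refine sum_congr rfl fun p hp => ?_
        have hp' := HasAntidiagonal.mem_antidiagonal.1 hp
        rw [← sum_antidiagonal_alternating_choose p.1 (n + a) (by omega), sum_mul]
        refine sum_congr rfl fun q hq => ?_
        rw [HasAntidiagonal.mem_antidiagonal.1 hq]
        ring

theorem poch_mul_hahn1 (n a x y : ℕ) (h : n ≤ x + y) :
    poch (-((x : ℝ) + y)) n * hahn1 n x 0 a (x + y) =
      (-1) ^ n * n.factorial * hahnCore n a x y := by
  rw [← sum_hahn_eq_hahnCore, Nat.sum_antidiagonal_eq_sum_range_succ_mk, hahn1, mul_sum, mul_sum]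
  refine sum_congr rfl fun k hk => ?_
  have hk : k ≤ n := by simpa [Nat.lt_succ_iff] using hk
  have e : (n : ℝ) + 0 + a + 1 = ((n + a : ℕ) : ℝ) + 1 := by push_cast; ring
  have e2 : ((x : ℝ) + y) = ((x + y : ℕ) : ℝ) := by push_cast; ring
  rw [e, e2, zero_add, poch_one, poch_natCast_add_one]
  simp only [poch_neg_natCast]
  have h1 : ((n + a + k).choose k : ℝ) * (n + a).factorial * k.factorial =
      (n + a + k).factorial := by exact_mod_cast Nat.add_choose_mul_factorial_mul_factorial _ _
  have h2 : ((x + y).choose n : ℝ) * n.choose k =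
      (x + y).choose k * (x + y - k).choose (n - k) := by
    exact_mod_cast Nat.choose_mul hk
  have h3 : (0 : ℝ) < (x + y).choose k := by exact_mod_cast Nat.choose_pos (by omega)
  have h4 : (0 : ℝ) < (n + a).factorial := by positivity
  have h5 : (0 : ℝ) < k.factorial := by positivity
  rw [← h1]
  field_simp
  have h6 : ((-1 : ℝ) ^ k) ^ 2 = 1 := by rw [← pow_mul, mul_comm, pow_mul]; simp
  linear_combination ((n + a + k).choose k : ℝ) * x.choose k * h2

/-! ### Raising and lowering operators on functions of a multi-index -/

theorem mem_ZN {d N : ℕ} {α : Fin (d + 1) → ℕ} : α ∈ ZN d N ↔ ∑ i, α i = N := by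
  simp only [ZN, mem_filter, Fintype.mem_piFinset, mem_range, and_iff_right_iff_imp]
  rintro rfl i
  exact Nat.lt_succ_of_le (single_le_sum (f := α) (fun _ _ => Nat.zero_le _) (mem_univ i))

theorem mem_idxSet {d N : ℕ} {ν : Fin d → ℕ} : ν ∈ idxSet d N ↔ ∑ i, ν i = N := by
  simp only [idxSet, mem_filter, Fintype.mem_piFinset, mem_range, and_iff_right_iff_imp]
  rintro rfl i
  exact Nat.lt_succ_of_le (single_le_sum (f := ν) (fun _ _ => Nat.zero_le _) (mem_univ i))

theorem sum_ZN_succ (d N : ℕ) (f : (Fin (d + 2) → ℕ) → ℝ) :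
    ∑ x ∈ ZN (d + 1) N, f x =
      ∑ p ∈ antidiagonal N, ∑ t ∈ ZN d p.2, f (Fin.cons p.1 t) := by
  rw [sum_sigma']
  refine sum_nbij' (fun x => ⟨(x 0, ∑ i, Fin.tail x i), Fin.tail x⟩)
    (fun z => Fin.cons z.1.1 z.2) ?_ ?_ ?_ ?_ ?_
  · intro x hx
    rw [mem_ZN, Fin.sum_univ_succ] at hx
    simpa [mem_ZN, Fin.tail] using hx
  · rintro ⟨⟨a, b⟩, t⟩ h
    simp only [mem_sigma, HasAntidiagonal.mem_antidiagonal, mem_ZN] at h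
    simp [mem_ZN, Fin.sum_univ_succ, h.1, h.2]
  · intro x _
    exact Fin.cons_self_tail x
  · rintro ⟨⟨a, b⟩, t⟩ h
    simp only [mem_sigma, HasAntidiagonal.mem_antidiagonal, mem_ZN] at h
    obtain ⟨-, rfl⟩ := h
    rfl
  · intro x _
    simp [Fin.cons_self_tail]

theorem sum_sub_single {m : ℕ} {x : Fin m → ℕ} {i : Fin m} (h : x i ≠ 0) :
    ∑ j, (x - Pi.single i 1 : Fin m → ℕ) j + 1 = ∑ j, x j := by
  have : x = (x - Pi.single i 1) + Pi.single i 1 := by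
    ext j
    rcases eq_or_ne j i with rfl | hj
    · simp; omega
    · simp [hj]
  conv_rhs => rw [this]
  simp [sum_add_distrib]

/-- The raising operator `f ↦ ∑ i, x i * f (x - e i)`. -/
noncomputable def raiseOp {m : ℕ} (f : (Fin m → ℕ) → ℝ) (x : Fin m → ℕ) : ℝ :=
  ∑ i, (x i : ℝ) * f (x - Pi.single i 1)

/-- The lowering operator `f ↦ ∑ i, (x i + 1) * f (x + e i)`. -/
noncomputable def lowerOp {m : ℕ} (f : (Fin m → ℕ) → ℝ) (x : Fin m → ℕ) : ℝ :=
  ∑ i, ((x i : ℝ) + 1) * f (x + Pi.single i 1)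

theorem raiseOp_cons {m : ℕ} (f : (Fin (m + 1) → ℕ) → ℝ) (a : ℕ) (t : Fin m → ℕ) :
    raiseOp f (Fin.cons a t) =
      a * f (Fin.cons (a - 1) t) + raiseOp (fun t' => f (Fin.cons a t')) t := by
  rw [raiseOp, raiseOp, Fin.sum_univ_succ]
  congr 1
  · simp only [Fin.cons_zero]
    congr 2
    ext j
    refine Fin.cases ?_ (fun j => ?_) j <;> simp
  · refine sum_congr rfl fun i _ => ?_
    simp only [Fin.cons_succ]
    congr 2
    ext j
    refine Fin.cases ?_ (fun j => ?_) j <;> simp [Pi.single_apply]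

theorem lowerOp_cons {m : ℕ} (f : (Fin (m + 1) → ℕ) → ℝ) (a : ℕ) (t : Fin m → ℕ) :
    lowerOp f (Fin.cons a t) =
      (a + 1) * f (Fin.cons (a + 1) t) + lowerOp (fun t' => f (Fin.cons a t')) t := by
  rw [lowerOp, lowerOp, Fin.sum_univ_succ]
  congr 1
  · simp only [Fin.cons_zero]
    congr 2
    ext j
    refine Fin.cases ?_ (fun j => ?_) j <;> simp
  · refine sum_congr rfl fun i _ => ?_
    simp only [Fin.cons_succ]
    congr 2
    ext j
    refine Fin.cases ?_ (fun j => ?_) j <;> simp [Pi.single_apply]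

/-- The raising and lowering operators are adjoint to each other. -/
theorem sum_raiseOp_mul (d N : ℕ) (f g : (Fin (d + 1) → ℕ) → ℝ) :
    ∑ y ∈ ZN d (N + 1), raiseOp f y * g y = ∑ z ∈ ZN d N, f z * lowerOp g z := by
  simp only [raiseOp, lowerOp, sum_mul, mul_sum]
  rw [sum_comm, sum_comm (s := ZN d N)]
  refine sum_congr rfl fun i _ => ?_
  rw [← sum_filter_of_ne (p := fun y => y i ≠ 0)]
  · refine sum_nbij' (fun y => y - Pi.single i 1) (fun z => z + Pi.single i 1) ?_ ?_ ?_ ?_ ?_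
    · intro y hy
      rw [mem_filter, mem_ZN] at hy
      have := sum_sub_single hy.2
      rw [mem_ZN]
      omega
    · intro z hz
      rw [mem_ZN] at hz
      simp [mem_ZN, sum_add_distrib, hz]
    · intro y hy
      ext j
      rcases eq_or_ne j i with rfl | hj
      · have := (mem_filter.1 hy).2
        simp; omega
      · simp [hj]
    · intro z _
      ext j
      simp
    · intro y hy
      have h0 := (mem_filter.1 hy).2
      have h1 : y - Pi.single i 1 + Pi.single i 1 = y := by
        ext j
        rcases eq_or_ne j i with rfl | hj
        · simp; omega
        · simp [hj]
      have h2 : (((y - Pi.single i 1 : Fin (d + 1) → ℕ) i : ℕ) : ℝ) + 1 = y i := by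
        rw [← Nat.cast_add_one]
        simp only [Pi.sub_apply, Pi.single_eq_same]
        congr 1
        omega
      rw [h1, h2]
      ring
  · intro y _ h h0
    simp [h0] at h

/-- The multi-index binomial coefficient `∏ i, C(x i, γ i)`. -/
noncomputable def mchoose {m : ℕ} (x γ : Fin m → ℕ) : ℝ :=
  ∏ i, ((x i).choose (γ i) : ℝ)

theorem mchoose_of_sum_eq {m : ℕ} {x γ : Fin m → ℕ} (h : ∑ i, x i = ∑ i, γ i) :
    mchoose x γ = if x = γ then 1 else 0 := by
  split_ifs with hx
  · subst hx
    simp [mchoose]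
  · have : ∃ i, x i < γ i := by
      by_contra! hc
      refine hx (funext fun i => ?_)
      have := (sum_eq_sum_iff_of_le fun i _ => hc i).1 h.symm i (mem_univ i)
      exact this.symm
    obtain ⟨i, hi⟩ := this
    exact prod_eq_zero (mem_univ i) (by simp [Nat.choose_eq_zero_of_lt hi])

theorem sum_mchoose_mul_self {d k : ℕ} {γ : Fin (d + 1) → ℕ} (hγ : γ ∈ ZN d k)
    (f : (Fin (d + 1) → ℕ) → ℝ) : ∑ y ∈ ZN d k, mchoose y γ * f y = f γ := by
  have h : ∀ y ∈ ZN d k, mchoose y γ * f y = if y = γ then f y else 0 := fun y hy => by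
    rw [mchoose_of_sum_eq ((mem_ZN.1 hy).trans (mem_ZN.1 hγ).symm), ite_mul, one_mul, zero_mul]
  rw [sum_congr rfl h]
  simp [hγ]

theorem mchoose_sum_self_mul {d k : ℕ} {x : Fin (d + 1) → ℕ} (hx : x ∈ ZN d k)
    (f : (Fin (d + 1) → ℕ) → ℝ) : ∑ y ∈ ZN d k, mchoose x y * f y = f x := by
  have h : ∀ y ∈ ZN d k, mchoose x y * f y = if x = y then f y else 0 := fun y hy => by
    rw [mchoose_of_sum_eq ((mem_ZN.1 hx).trans (mem_ZN.1 hy).symm), ite_mul, one_mul, zero_mul]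
  rw [sum_congr rfl h]
  simp [hx]

theorem raiseOp_mchoose {m : ℕ} (γ x : Fin m → ℕ) :
    raiseOp (fun y => mchoose y γ) x =
      (((∑ i, x i : ℕ) : ℝ) - (∑ i, γ i : ℕ)) * mchoose x γ := by
  push_cast
  rw [raiseOp, ← sum_sub_distrib, sum_mul]
  refine sum_congr rfl fun i _ => ?_
  rw [mchoose, mchoose, ← mul_prod_erase _ _ (mem_univ i), ← mul_prod_erase _ _ (mem_univ i),
    ← mul_assoc, ← mul_assoc]
  congr 1
  · simpa using mul_choose_pred_cast (x i) (γ i)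
  · refine prod_congr rfl fun j hj => ?_
    simp [Pi.single_eq_of_ne (ne_of_mem_erase hj)]

theorem sum_mchoose_mul_of_raiseOp {d n : ℕ} {f : (Fin (d + 1) → ℕ) → ℝ}
    (hf : ∀ x, raiseOp f x = (((∑ i, x i : ℕ) : ℝ) - n) * f x) {k N : ℕ} (hnk : n ≤ k)
    (hkN : k ≤ N) {x : Fin (d + 1) → ℕ} (hx : x ∈ ZN d N) :
    ∑ γ ∈ ZN d k, mchoose x γ * f γ = (N - n).choose (k - n) * f x := by
  induction N, hkN using Nat.le_induction generalizing x with
  | base => rw [mchoose_sum_self_mul hx, Nat.choose_self, Nat.cast_one, one_mul]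
  | succ N hkN ih =>
    have hxN := mem_ZN.1 hx
    have h1 : ((N : ℝ) + 1 - k) * ∑ γ ∈ ZN d k, mchoose x γ * f γ =
        ∑ γ ∈ ZN d k, raiseOp (fun y => mchoose y γ) x * f γ := by
      rw [mul_sum]
      refine sum_congr rfl fun γ hγ => ?_
      rw [raiseOp_mchoose, mem_ZN.1 hγ, hxN]
      push_cast
      ring
    have h2 : ∑ γ ∈ ZN d k, raiseOp (fun y => mchoose y γ) x * f γ =
        (N - n).choose (k - n) * raiseOp f x := by
      simp only [raiseOp, sum_mul]
      rw [sum_comm, mul_sum]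
      refine sum_congr rfl fun i _ => ?_
      rcases eq_or_ne (x i) 0 with h0 | h0
      · simp [h0]
      · have hm : x - Pi.single i 1 ∈ ZN d N := by
          have := sum_sub_single h0
          rw [mem_ZN]
          omega
        simp only [mul_assoc]
        rw [← mul_sum, ih hm]
        ring
    have h3 := succ_mul_choose_cast (N - n) (k - n)
    rw [show N - n + 1 = N + 1 - n by omega, Nat.cast_sub (by omega), Nat.cast_sub hnk] at h3
    have h4 : (N : ℝ) + 1 - k ≠ 0 := by
      have : (k : ℝ) ≤ N := by exact_mod_cast hkN
      linarith
    apply mul_left_cancel₀ h4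
    rw [h1, h2, hf, hxN]
    push_cast
    linear_combination f x * h3

theorem sum_mchoose_mul_of_lowerOp {d e : ℕ} {f : (Fin (d + 1) → ℕ) → ℝ}
    (hf : ∀ x, lowerOp f x = (((∑ i, x i : ℕ) : ℝ) + e + 1) * f x) {k : ℕ} (t : ℕ)
    {γ : Fin (d + 1) → ℕ} (hγ : γ ∈ ZN d k) :
    ∑ y ∈ ZN d (k + t), mchoose y γ * f y = (k + t + e).choose t * f γ := by
  induction t with
  | zero => simp [sum_mchoose_mul_self hγ]
  | succ t ih =>
    have h1 : ((t : ℝ) + 1) * ∑ y ∈ ZN d (k + (t + 1)), mchoose y γ * f y =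
        ∑ y ∈ ZN d (k + t + 1), raiseOp (fun y => mchoose y γ) y * f y := by
      rw [mul_sum]
      refine sum_congr rfl fun y hy => ?_
      rw [raiseOp_mchoose, mem_ZN.1 hγ, mem_ZN.1 hy]
      push_cast
      ring
    have h2 : ∑ z ∈ ZN d (k + t), mchoose z γ * lowerOp f z =
        ((k : ℝ) + t + e + 1) * ∑ z ∈ ZN d (k + t), mchoose z γ * f z := by
      rw [mul_sum]
      refine sum_congr rfl fun z hz => ?_
      rw [hf, mem_ZN.1 hz]
      push_cast
      ring
    have h3 : ((k + t + e + 1 : ℕ) : ℝ) * (k + t + e).choose t =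
        (k + t + e + 1).choose (t + 1) * ((t + 1 : ℕ) : ℝ) := by
      exact_mod_cast Nat.add_one_mul_choose_eq (k + t + e) t
    apply mul_left_cancel₀ (show (t : ℝ) + 1 ≠ 0 by positivity)
    rw [h1, sum_raiseOp_mul, h2, ih, show k + (t + 1) + e = k + t + e + 1 by ring]
    push_cast at h3
    linear_combination f γ * h3

/-! ### Homogeneous Hahn polynomials of several variables with parameter `0` -/

/-- The Hahn polynomial `H_ν(x; 0, |x|)`, up to a factor depending only on `ν` and `|x|`. -/
noncomputable def hahnG : (d : ℕ) → (Fin d → ℕ) → (Fin (d + 1) → ℕ) → ℝ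
  | 0, _, _ => 1
  | d + 1, ν, x =>
    hahnCore (ν 0) (2 * ∑ i, Fin.tail ν i + d) (x 0) (∑ i, Fin.tail x i - ∑ i, Fin.tail ν i) *
      hahnG d (Fin.tail ν) (Fin.tail x)

theorem hahnG_cons (d n : ℕ) (μ : Fin d → ℕ) (a : ℕ) (t : Fin (d + 1) → ℕ) :
    hahnG (d + 1) (Fin.cons n μ) (Fin.cons a t) =
      hahnCore n (2 * ∑ i, μ i + d) a (∑ i, t i - ∑ i, μ i) * hahnG d μ t := rfl

theorem hahnG_eq_zero {d : ℕ} {ν : Fin d → ℕ} {x : Fin (d + 1) → ℕ}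
    (h : ∑ i, x i < ∑ i, ν i) : hahnG d ν x = 0 := by
  induction d with
  | zero => simp at h
  | succ d ih =>
    rw [Fin.sum_univ_succ, Fin.sum_univ_succ (f := ν)] at h
    rw [hahnG]
    rcases lt_or_ge (∑ i, Fin.tail x i) (∑ i, Fin.tail ν i) with h1 | h1
    · rw [ih h1, mul_zero]
    · rw [hahnCore_eq_zero, zero_mul]
      simp only [Fin.tail] at h1 ⊢
      omega

theorem raiseOp_hahnG (d : ℕ) (ν : Fin d → ℕ) (x : Fin (d + 1) → ℕ) :
    raiseOp (hahnG d ν) x =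
      (((∑ i, x i : ℕ) : ℝ) - (∑ i, ν i : ℕ)) * hahnG d ν x := by
  induction d with
  | zero => simp [raiseOp, hahnG]
  | succ d ih =>
    obtain ⟨a, t, rfl⟩ : ∃ a t, x = Fin.cons a t := ⟨x 0, Fin.tail x, (Fin.cons_self_tail x).symm⟩
    obtain ⟨n, μ, rfl⟩ : ∃ n μ, ν = Fin.cons n μ := ⟨ν 0, Fin.tail ν, (Fin.cons_self_tail ν).symm⟩
    have h1 : raiseOp (fun t' => hahnG (d + 1) (Fin.cons n μ) (Fin.cons a t')) t =
        hahnCore n (2 * ∑ i, μ i + d) a (∑ i, t i - ∑ i, μ i - 1) *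
          raiseOp (hahnG d μ) t := by
      rw [raiseOp, raiseOp, mul_sum]
      refine sum_congr rfl fun i _ => ?_
      rcases eq_or_ne (t i) 0 with h0 | h0
      · simp [h0]
      · have := sum_sub_single h0
        rw [hahnG_cons,
          show ∑ j, (t - Pi.single i 1 : Fin (d + 1) → ℕ) j - ∑ i, μ i =
            ∑ i, t i - ∑ i, μ i - 1 by omega]
        ring
    rw [raiseOp_cons, h1, hahnG_cons, hahnG_cons, ih, Fin.sum_cons, Fin.sum_cons]
    rcases lt_or_ge (∑ i, t i) (∑ i, μ i) with h | h
    · rw [hahnG_eq_zero h]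
      ring
    · obtain ⟨y, hy⟩ := Nat.exists_eq_add_of_le h
      have := hahnCore_raise n (2 * ∑ i, μ i + d) a y
      rw [hy, Nat.add_sub_cancel_left]
      push_cast at this ⊢
      linear_combination hahnG d μ t * this

theorem lowerOp_hahnG (d : ℕ) (ν : Fin d → ℕ) (x : Fin (d + 1) → ℕ) :
    lowerOp (hahnG d ν) x =
      (((∑ i, x i : ℕ) : ℝ) + (∑ i, ν i + d : ℕ) + 1) * hahnG d ν x := by
  induction d with
  | zero => simp [lowerOp, hahnG]
  | succ d ih =>
    obtain ⟨a, t, rfl⟩ : ∃ a t, x = Fin.cons a t := ⟨x 0, Fin.tail x, (Fin.cons_self_tail x).symm⟩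
    obtain ⟨n, μ, rfl⟩ : ∃ n μ, ν = Fin.cons n μ := ⟨ν 0, Fin.tail ν, (Fin.cons_self_tail ν).symm⟩
    have h1 : lowerOp (fun t' => hahnG (d + 1) (Fin.cons n μ) (Fin.cons a t')) t =
        hahnCore n (2 * ∑ i, μ i + d) a (∑ i, t i + 1 - ∑ i, μ i) *
          lowerOp (hahnG d μ) t := by
      rw [lowerOp, lowerOp, mul_sum]
      refine sum_congr rfl fun i _ => ?_
      rw [hahnG_cons, show ∑ j, (t + Pi.single i 1 : Fin (d + 1) → ℕ) j = ∑ i, t i + 1 by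
        simp [sum_add_distrib]]
      ring
    rw [lowerOp_cons, h1, hahnG_cons, hahnG_cons, ih, Fin.sum_cons, Fin.sum_cons]
    rcases lt_or_ge (∑ i, t i) (∑ i, μ i) with h | h
    · rw [hahnG_eq_zero h]
      ring
    · obtain ⟨y, hy⟩ := Nat.exists_eq_add_of_le h
      have := hahnCore_lower n (2 * ∑ i, μ i + d) a y
      rw [hy, Nat.add_sub_cancel_left, show ∑ i, μ i + y + 1 - ∑ i, μ i = y + 1 by omega]
      push_cast at this ⊢
      linear_combination hahnG d μ t * this

/-! ### The parameters `aj` and partial sums under `Fin.cons` -/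

theorem sum_filter_zero_lt {m : ℕ} {M : Type*} [AddCommMonoid M] (f : Fin (m + 1) → M) :
    ∑ i ∈ univ.filter (fun i : Fin (m + 1) => ((0 : Fin (m + 1)) : ℕ) < (i : ℕ)), f i =
      ∑ i : Fin m, f i.succ := by
  rw [sum_filter, Fin.sum_univ_succ]
  simp

theorem sum_filter_succ_lt {m : ℕ} {M : Type*} [AddCommMonoid M] (f : Fin (m + 1) → M)
    (j : Fin m) :
    ∑ i ∈ univ.filter (fun i : Fin (m + 1) => (j.succ : ℕ) < (i : ℕ)), f i =
      ∑ i ∈ univ.filter (fun i : Fin m => (j : ℕ) < (i : ℕ)), f i.succ := by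
  rw [sum_filter, Fin.sum_univ_succ, sum_filter]
  simp

theorem aj_cons_zero (d n : ℕ) (μ : Fin d → ℕ) :
    aj (d + 1) (fun _ => 0) (Fin.cons n μ) 0 = ((2 * ∑ i, μ i + d : ℕ) : ℝ) := by
  rw [aj, sum_filter_zero_lt]
  simp

theorem aj_cons_succ (d n : ℕ) (μ : Fin d → ℕ) (j : Fin d) :
    aj (d + 1) (fun _ => 0) (Fin.cons n μ) j.succ = aj d (fun _ => 0) μ j := by
  rw [aj, aj, sum_filter_succ_lt]
  simp only [sum_const_zero, zero_add, Fin.cons_succ, Fin.val_succ]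
  congr 2
  omega

theorem aj_eq_natCast (d : ℕ) (ν : Fin d → ℕ) (j : Fin d) :
    ∃ a : ℕ, aj d (fun _ => 0) ν j = a :=
  ⟨2 * (∑ i ∈ univ.filter (fun i : Fin d => (j : ℕ) < (i : ℕ)), ν i) + (d - 1 - j), by simp [aj]⟩

theorem poch_aj_pos (d : ℕ) (ν : Fin d → ℕ) (j : Fin d) (k : ℕ) :
    0 < poch (aj d (fun _ => 0) ν j + 1) k := by
  obtain ⟨a, ha⟩ := aj_eq_natCast d ν j
  rw [ha]
  exact poch_natCast_add_one_pos a k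

theorem sumGt_cons_zero (d n : ℕ) (μ : Fin d → ℕ) :
    sumGt (d + 1) (Fin.cons n μ) 0 = ((∑ i, μ i : ℕ) : ℝ) := by
  rw [sumGt, sum_filter_zero_lt]
  simp

theorem sumGt_cons_succ (d n : ℕ) (μ : Fin d → ℕ) (j : Fin d) :
    sumGt (d + 1) (Fin.cons n μ) j.succ = sumGt d μ j := by
  rw [sumGt, sumGt, sum_filter_succ_lt]
  simp

theorem sumLt_zero (d : ℕ) (x : Fin (d + 2) → ℕ) : sumLt (d + 1) x 0 = 0 := by
  simp [sumLt]

theorem sumLt_cons_succ (d a : ℕ) (t : Fin (d + 1) → ℕ) (j : Fin d) :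
    sumLt (d + 1) (Fin.cons a t) j.succ = a + sumLt d t j := by
  rw [sumLt, sumLt, sum_filter, sum_filter, Fin.sum_univ_succ]
  simp

/-! ### Orthogonality -/

/-- The constant `∏ j, (a_j + 1)_{2 ν_j} / (ν_j !)²` in the squared norm of `hahnG`. -/
noncomputable def hahnA (d : ℕ) (ν : Fin d → ℕ) : ℝ :=
  ∏ j, poch (aj d (fun _ => 0) ν j + 1) (2 * ν j) / ((ν j).factorial : ℝ) ^ 2

theorem hahnA_pos (d : ℕ) (ν : Fin d → ℕ) : 0 < hahnA d ν :=
  prod_pos fun j _ => div_pos (poch_aj_pos d ν j _) (by positivity)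

theorem hahnA_cons (d n : ℕ) (μ : Fin d → ℕ) :
    hahnA (d + 1) (Fin.cons n μ) =
      poch (((2 * ∑ i, μ i + d : ℕ) : ℝ) + 1) (2 * n) / (n.factorial : ℝ) ^ 2 * hahnA d μ := by
  rw [hahnA, Fin.prod_univ_succ, aj_cons_zero]
  simp only [aj_cons_succ, Fin.cons_succ, Fin.cons_zero, hahnA]

theorem sum_hahnG_mul_succ {d N : ℕ} (ν μ : Fin d → ℕ) :
    ((N : ℝ) + 1 - (∑ i, ν i : ℕ)) * ∑ x ∈ ZN d (N + 1), hahnG d ν x * hahnG d μ x =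
      ((N : ℝ) + 1 + (∑ i, μ i + d : ℕ)) * ∑ x ∈ ZN d N, hahnG d ν x * hahnG d μ x := by
  have h := sum_raiseOp_mul d N (hahnG d ν) (hahnG d μ)
  rw [mul_sum, mul_sum]
  refine (sum_congr rfl fun x hx => ?_).trans (h.trans (sum_congr rfl fun x hx => ?_))
  · rw [raiseOp_hahnG, mem_ZN.1 hx]
    push_cast
    ring
  · rw [lowerOp_hahnG, mem_ZN.1 hx]
    push_cast
    ring

theorem sum_hahnG_mul_of_lt {d : ℕ} {ν μ : Fin d → ℕ} (h : ∑ i, ν i < ∑ i, μ i) (N : ℕ) :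
    ∑ x ∈ ZN d N, hahnG d ν x * hahnG d μ x = 0 := by
  induction N with
  | zero =>
    refine sum_eq_zero fun x hx => ?_
    rw [hahnG_eq_zero (ν := μ) (by rw [mem_ZN.1 hx]; omega), mul_zero]
  | succ N ih =>
    rcases lt_or_ge (N + 1) (∑ i, μ i) with h1 | h1
    · refine sum_eq_zero fun x hx => ?_
      rw [hahnG_eq_zero (ν := μ) (by rw [mem_ZN.1 hx]; omega), mul_zero]
    · have h2 := sum_hahnG_mul_succ (N := N) ν μ
      rw [ih, mul_zero] at h2
      refine (mul_eq_zero.1 h2).resolve_left ?_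
      have : ((∑ i, ν i : ℕ) : ℝ) < N + 1 := by exact_mod_cast h.trans_le h1
      linarith

theorem sum_hahnG_mul_add {d n : ℕ} {ν μ : Fin d → ℕ} (hν : ∑ i, ν i = n) (hμ : ∑ i, μ i = n)
    (t : ℕ) :
    ∑ x ∈ ZN d (n + t), hahnG d ν x * hahnG d μ x =
      (n + t + n + d).choose t * ∑ x ∈ ZN d n, hahnG d ν x * hahnG d μ x := by
  induction t with
  | zero => simp
  | succ t ih =>
    have h := sum_hahnG_mul_succ (N := n + t) ν μ
    rw [ih, hν, hμ] at h
    have h3 : ((n + t + n + d + 1 : ℕ) : ℝ) * (n + t + n + d).choose t =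
        (n + t + n + d + 1).choose (t + 1) * ((t + 1 : ℕ) : ℝ) := by
      exact_mod_cast Nat.add_one_mul_choose_eq (n + t + n + d) t
    rw [show n + (t + 1) + n + d = n + t + n + d + 1 by ring]
    apply mul_left_cancel₀ (show (t : ℝ) + 1 ≠ 0 by positivity)
    push_cast at h h3
    linear_combination h + (∑ x ∈ ZN d n, hahnG d ν x * hahnG d μ x) * h3

theorem sum_antidiagonal_choose_sq (n a : ℕ) :
    ∑ p ∈ antidiagonal n, ((n + a).choose p.1 : ℝ) ^ 2 * (p.2 + a).choose p.2 =
      poch ((a : ℝ) + 1) (2 * n) / (n.factorial : ℝ) ^ 2 := by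
  have h1 : ∀ p ∈ antidiagonal n, ((n + a).choose p.1 : ℝ) ^ 2 * (p.2 + a).choose p.2 =
      (n + a).choose n * ((n + a).choose p.1 * n.choose p.2) := by
    intro p hp
    rw [HasAntidiagonal.mem_antidiagonal] at hp
    obtain ⟨k, q⟩ := p
    simp only at hp
    subst hp
    have h := Nat.choose_mul (n := k + q + a) (k := k + q) (s := k) (by omega)
    rw [show k + q + a - k = q + a by omega, show k + q - k = q by omega] at h
    have h' : ((k + q + a).choose (k + q) * (k + q).choose k : ℝ) =
      (k + q + a).choose k * (q + a).choose q := by exact_mod_cast h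
    rw [show (k + q).choose q = (k + q).choose k from (Nat.choose_symm_add).symm]
    simp only
    linear_combination -((k + q + a).choose k : ℝ) * h'
  rw [sum_congr rfl h1, ← mul_sum]
  have h2 : ∑ p ∈ antidiagonal n, ((n + a).choose p.1 * n.choose p.2 : ℝ) =
      (n + a + n).choose n := by
    rw [Nat.add_choose_eq]
    push_cast
    rfl
  rw [h2, poch_natCast_add_one, Nat.cast_choose ℝ (Nat.le_add_left n (n + a)),
    Nat.cast_choose ℝ (Nat.le_add_right n a), Nat.add_sub_cancel_left, Nat.add_sub_cancel,
    show n + a + n = a + 2 * n by ring]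
  field_simp

theorem sum_hahnG_mul_self {d n : ℕ} {ν μ : Fin d → ℕ} (hν : ∑ i, ν i = n) (hμ : ∑ i, μ i = n) :
    ∑ x ∈ ZN d n, hahnG d ν x * hahnG d μ x = if ν = μ then hahnA d ν else 0 := by
  induction d generalizing n with
  | zero =>
    obtain rfl : n = 0 := by simpa using hν.symm
    have : ZN 0 0 = {0} := by
      ext x
      rw [mem_ZN]
      simp [funext_iff]
    rw [this]
    simp [hahnG, hahnA, Subsingleton.elim ν μ]
  | succ d ih =>
    obtain ⟨n₁, ν, rfl⟩ : ∃ n μ, ν = Fin.cons n μ := ⟨ν 0, Fin.tail ν, (Fin.cons_self_tail ν).symm⟩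
    obtain ⟨n₂, μ, rfl⟩ : ∃ n μ', μ = Fin.cons n μ' :=
      ⟨μ 0, Fin.tail μ, (Fin.cons_self_tail μ).symm⟩
    rw [Fin.sum_cons] at hν hμ
    rw [sum_ZN_succ]
    have h1 : ∀ p : ℕ × ℕ, ∑ t ∈ ZN d p.2,
        hahnG (d + 1) (Fin.cons n₁ ν) (Fin.cons p.1 t) *
          hahnG (d + 1) (Fin.cons n₂ μ) (Fin.cons p.1 t) =
        hahnCore n₁ (2 * ∑ i, ν i + d) p.1 (p.2 - ∑ i, ν i) *
          hahnCore n₂ (2 * ∑ i, μ i + d) p.1 (p.2 - ∑ i, μ i) *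
          ∑ t ∈ ZN d p.2, hahnG d ν t * hahnG d μ t := by
      intro p
      rw [mul_sum]
      refine sum_congr rfl fun t ht => ?_
      rw [hahnG_cons, hahnG_cons, mem_ZN.1 ht]
      ring
    simp only [h1]
    have h0 : ∀ N, ν ≠ μ → ∑ t ∈ ZN d N, hahnG d ν t * hahnG d μ t = 0 := by
      intro N hne
      rcases lt_trichotomy (∑ i, ν i) (∑ i, μ i) with h | h | h
      · exact sum_hahnG_mul_of_lt h N
      · rcases lt_or_ge N (∑ i, ν i) with hN | hN
        · refine sum_eq_zero fun x hx => ?_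
          rw [hahnG_eq_zero (ν := ν) (by rwa [mem_ZN.1 hx]), zero_mul]
        · obtain ⟨t, rfl⟩ := Nat.exists_eq_add_of_le hN
          rw [sum_hahnG_mul_add rfl h.symm, ih rfl h.symm, if_neg hne, mul_zero]
      · rw [← sum_hahnG_mul_of_lt h N]
        exact sum_congr rfl fun x _ => mul_comm _ _
    by_cases hne : ν = μ
    swap
    · rw [if_neg (fun h => hne (Fin.cons_injective2 h).2)]
      exact sum_eq_zero fun p _ => by rw [h0 _ hne, mul_zero]
    subst hne
    obtain rfl : n₁ = n₂ := by omega
    rw [if_pos rfl, hahnA_cons, ← sum_antidiagonal_choose_sq, sum_mul]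
    set s := ∑ i, ν i with hs
    subst hν
    symm
    refine sum_of_injOn (fun p => (p.1, p.2 + s)) ?_ ?_ ?_ ?_
    · rintro ⟨a, b⟩ _ ⟨a', b'⟩ _ h
      simp only [Prod.mk.injEq, Nat.add_right_cancel_iff] at h
      simp [h]
    · rintro ⟨a, b⟩ hp
      simp only [mem_coe, HasAntidiagonal.mem_antidiagonal] at hp ⊢
      omega
    · rintro ⟨a, b⟩ hp hnot
      rw [HasAntidiagonal.mem_antidiagonal] at hp
      have hb : b < s := by
        by_contra! hb
        refine hnot ⟨(a, b - s), ?_, ?_⟩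
        · simp only [mem_coe, HasAntidiagonal.mem_antidiagonal] at hp ⊢
          omega
        · simp [Nat.sub_add_cancel hb]
      rw [sum_eq_zero, mul_zero]
      intro x hx
      rw [hahnG_eq_zero (by rwa [mem_ZN.1 hx]), zero_mul]
    · rintro ⟨k, q⟩ hp
      rw [HasAntidiagonal.mem_antidiagonal] at hp
      simp only at hp
      subst hp
      simp only [Nat.add_sub_cancel]
      rw [hahnCore_of_add_eq, add_comm q s, sum_hahnG_mul_add hs.symm hs.symm,
        ih hs.symm hs.symm, if_pos rfl]
      have e : ((-1 : ℝ) ^ k) ^ 2 = 1 := by rw [← pow_mul, mul_comm, pow_mul]; simp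
      rw [show s + q + s + d = q + (2 * s + d) by ring]
      linear_combination -((k + q + (2 * s + d)).choose k : ℝ) ^ 2 *
        (q + (2 * s + d)).choose q * hahnA d ν * e

/-- The squared norm of `hahnG d ν` on `ZN d N`. -/
noncomputable def hahnC (d N : ℕ) (ν : Fin d → ℕ) : ℝ :=
  hahnA d ν * (N + ∑ i, ν i + d).choose (2 * ∑ i, ν i + d)

theorem hahnC_pos {d N : ℕ} {ν : Fin d → ℕ} (h : ∑ i, ν i ≤ N) : 0 < hahnC d N ν :=
  mul_pos (hahnA_pos d ν) (by exact_mod_cast Nat.choose_pos (by omega))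

theorem sum_hahnG_mul {d N : ℕ} {ν μ : Fin d → ℕ} (hν : ∑ i, ν i ≤ N) :
    ∑ x ∈ ZN d N, hahnG d ν x * hahnG d μ x = if ν = μ then hahnC d N ν else 0 := by
  rcases lt_trichotomy (∑ i, ν i) (∑ i, μ i) with h | h | h
  · rw [sum_hahnG_mul_of_lt h N, if_neg (by rintro rfl; omega)]
  · obtain ⟨t, rfl⟩ := Nat.exists_eq_add_of_le hν
    rw [sum_hahnG_mul_add rfl h.symm, sum_hahnG_mul_self rfl h.symm, mul_ite, mul_zero, hahnC]
    rw [Nat.choose_symm_of_eq_add (n := ∑ i, ν i + t + ∑ i, ν i + d) (a := t)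
      (b := 2 * ∑ i, ν i + d) (by ring), mul_comm]
  · rw [if_neg (by rintro rfl; omega), ← sum_hahnG_mul_of_lt h N]
    exact sum_congr rfl fun x _ => mul_comm _ _

/-! ### Completeness -/

/-- The multi-indices of degree at most `N`. -/
def lowSet (d N : ℕ) : Finset (Fin d → ℕ) :=
  (Fintype.piFinset fun _ => Finset.range (N + 1)).filter fun ν => ∑ i, ν i ≤ N

theorem mem_lowSet {d N : ℕ} {ν : Fin d → ℕ} : ν ∈ lowSet d N ↔ ∑ i, ν i ≤ N := by
  simp only [lowSet, mem_filter, Fintype.mem_piFinset, mem_range, and_iff_right_iff_imp]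
  intro h i
  exact Nat.lt_succ_of_le
    ((single_le_sum (f := ν) (fun _ _ => Nat.zero_le _) (mem_univ i)).trans h)

/-- Forgetting the first coordinate identifies `ZN d N` with the indices of degree `≤ N`. -/
def equivLowSet (d N : ℕ) : ZN d N ≃ lowSet d N where
  toFun x := ⟨Fin.tail x.1, by
    have h := mem_ZN.1 x.2
    rw [Fin.sum_univ_succ] at h
    rw [mem_lowSet]
    simp only [Fin.tail]
    omega⟩
  invFun ν := ⟨Fin.cons (N - ∑ i, ν.1 i) ν.1, by
    have h := mem_lowSet.1 ν.2
    rw [mem_ZN, Fin.sum_cons]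
    omega⟩
  left_inv x := by
    have h := mem_ZN.1 x.2
    rw [Fin.sum_univ_succ] at h
    refine Subtype.ext ?_
    simp only
    rw [show N - ∑ i, Fin.tail x.1 i = x.1 0 by simp only [Fin.tail]; omega]
    exact Fin.cons_self_tail x.1
  right_inv ν := rfl

theorem sum_lowSet_hahnG {d N : ℕ} {x y : Fin (d + 1) → ℕ} (hx : x ∈ ZN d N) (hy : y ∈ ZN d N) :
    ∑ ν ∈ lowSet d N, hahnG d ν x * hahnG d ν y / hahnC d N ν = if x = y then 1 else 0 := by
  let P : Matrix (lowSet d N) (ZN d N) ℝ := fun ν x => hahnG d ν.1 x.1 / hahnC d N ν.1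
  let P' : Matrix (ZN d N) (lowSet d N) ℝ := fun x ν => hahnG d ν.1 x.1
  have h1 : P * P' = 1 := by
    ext ν μ
    have hν := mem_lowSet.1 ν.2
    have h := sum_hahnG_mul (μ := μ.1) hν
    rw [Matrix.mul_apply, Matrix.one_apply]
    simp only [P, P', div_mul_eq_mul_div]
    rw [← sum_div, sum_coe_sort (ZN d N) (fun x => hahnG d ν.1 x * hahnG d μ.1 x), h]
    simp only [Subtype.ext_iff]
    split_ifs
    · exact div_self (hahnC_pos hν).ne'
    · exact zero_div _
  have h2 := (Matrix.mul_eq_one_comm_of_equiv (equivLowSet d N).symm).1 h1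
  have h3 := congrFun (congrFun h2 ⟨x, hx⟩) ⟨y, hy⟩
  rw [Matrix.mul_apply, Matrix.one_apply] at h3
  simp only [P, P', Subtype.mk.injEq] at h3
  rw [← h3, ← sum_coe_sort (lowSet d N)]
  exact sum_congr rfl fun ν _ => mul_div_assoc _ _ _

/-! ### The projection kernel -/

theorem pochV_neg_natCast {m : ℕ} (x γ : Fin m → ℕ) :
    pochV (fun i => -(x i : ℝ)) γ = (-1) ^ (∑ i, γ i) * mfact γ * mchoose x γ := by
  simp only [pochV, mfact, mchoose, poch_neg_natCast, prod_mul_distrib, prod_pow_eq_pow_sum]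

theorem pochV_one {m : ℕ} (γ : Fin m → ℕ) : pochV (fun _ => 1) γ = mfact γ := by
  simp [pochV, mfact, poch_one]

theorem mfact_pos {m : ℕ} (γ : Fin m → ℕ) : 0 < mfact γ :=
  prod_pos fun _ _ => by positivity

theorem neg_one_pow_mul_self (k : ℕ) : (-1 : ℝ) ^ k * (-1) ^ k = 1 := by
  rw [← mul_pow]
  simp

theorem sum_below_mchoose {d n : ℕ} {β : Fin (d + 1) → ℕ} (hβ : β ∈ ZN d n)
    (f : (Fin (d + 1) → ℕ) → ℝ) :
    ∑ γ ∈ below β, mchoose β γ * f γ =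
      ∑ k ∈ range (n + 1), ∑ γ ∈ ZN d k, mchoose β γ * f γ := by
  rw [← sum_fiberwise_of_maps_to (t := range (n + 1)) (g := fun γ => ∑ i, γ i)]
  · refine sum_congr rfl fun k _ => sum_subset ?_ ?_
    · intro γ hγ
      exact mem_ZN.2 (mem_filter.1 hγ).2
    · intro γ hγ hnot
      have : ∃ i, β i < γ i := by
        by_contra! hc
        exact hnot (mem_filter.2 ⟨by simpa [below, Nat.lt_succ_iff] using hc, mem_ZN.1 hγ⟩)
      obtain ⟨i, hi⟩ := this
      rw [mchoose, prod_eq_zero (mem_univ i) (by simp [Nat.choose_eq_zero_of_lt hi]), zero_mul]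
  · intro γ hγ
    rw [below, Fintype.mem_piFinset] at hγ
    rw [mem_range, ← mem_ZN.1 hβ, Nat.lt_succ_iff]
    exact sum_le_sum fun i _ => by simpa [Nat.lt_succ_iff] using hγ i

theorem monicQ_zero {d N n : ℕ} {β : Fin (d + 1) → ℕ} (hβ : β ∈ ZN d n) (x : Fin (d + 1) → ℕ) :
    monicQ d N (fun _ => 0) β (fun i => (x i : ℝ)) =
      poch (-(N : ℝ)) n * mfact β / poch ((d : ℝ) + n) n *
        ∑ k ∈ range (n + 1), poch ((d : ℝ) + n) k / poch (-(N : ℝ)) k *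
          ∑ γ ∈ ZN d k, mchoose β γ * mchoose x γ := by
  have hβ' := mem_ZN.1 hβ
  have h := sum_below_mchoose hβ (fun γ => poch ((d : ℝ) + n) (∑ i, γ i) /
    poch (-(N : ℝ)) (∑ i, γ i) * mchoose x γ)
  have h1 : ∀ k, poch ((d : ℝ) + n) k / poch (-(N : ℝ)) k *
      ∑ γ ∈ ZN d k, mchoose β γ * mchoose x γ = ∑ γ ∈ ZN d k, mchoose β γ *
        (poch ((d : ℝ) + n) (∑ i, γ i) / poch (-(N : ℝ)) (∑ i, γ i) * mchoose x γ) := by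
    intro k
    rw [mul_sum]
    refine sum_congr rfl fun γ hγ => ?_
    rw [mem_ZN.1 hγ]
    ring
  simp only [h1]
  rw [← h]
  simp only [monicQ, pochV_one, mono, pochV_neg_natCast, sum_const_zero, zero_add, hβ']
  congr 1
  refine sum_congr rfl fun γ _ => ?_
  have hm := (mfact_pos γ).ne'
  have hs := neg_one_pow_mul_self (∑ i, γ i)
  generalize (-1 : ℝ) ^ (∑ i, γ i) = s at hs ⊢
  by_cases hN : poch (-(N : ℝ)) (∑ i, γ i) = 0
  · simp [hN]
  · field_simp
    linear_combination (s ^ 2 + 1) * mchoose β γ * poch ((d : ℝ) + n) (∑ i, γ i) * mchoose x γ * hs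

/-- The coefficients expressing `monicQn` through the kernels
`∑ γ ∈ ZN d k, mchoose α γ * mchoose x γ`, where `d = e + 1`. -/
noncomputable def projCoeff (e N n k : ℕ) : ℝ :=
  (-1) ^ (n + k) * (2 * n + e + 1) * (e + n + k).factorial * ((N - k).factorial : ℝ) ^ 2 /
    ((N + n + e + 1).factorial * (n - k).factorial * (N - n).factorial)

theorem sum_projCoeff_mul (e N n m : ℕ) (hn : n ≤ N) :
    ∑ k ∈ range (n + 1), projCoeff e N n k *
      (if m ≤ k then ((N - m).choose (k - m) : ℝ) * (N + m + (e + 1)).choose (N - k) else 0) =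
      if m = n then 1 else 0 := by
  rcases lt_or_ge n m with hmn | hmn
  · rw [if_neg (by omega)]
    refine sum_eq_zero fun k hk => ?_
    rw [if_neg (by rw [mem_range] at hk; omega), mul_zero]
  obtain ⟨r, rfl⟩ := Nat.exists_eq_add_of_le hmn
  obtain ⟨N, rfl⟩ := Nat.exists_eq_add_of_le hn
  have key : ∀ i ∈ range (r + 1), projCoeff e (m + r + N) (m + r) (m + i) *
      (((m + r + N - m).choose (m + i - m) : ℝ) *
        (m + r + N + m + (e + 1)).choose (m + r + N - (m + i))) =
      ((2 * (m + r) + e + 1) * (r + N).factorial * (m + r + N + m + e + 1).factorial /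
        ((m + r + N + (m + r) + e + 1).factorial * N.factorial)) *
      ((-1) ^ (r + i) * (e + 2 * m + r + i).factorial /
        ((r - i).factorial * i.factorial * (2 * m + e + 1 + i).factorial)) := by
    intro i hi
    obtain ⟨j, rfl⟩ := Nat.exists_eq_add_of_le (show i ≤ r by rw [mem_range] at hi; omega)
    rw [projCoeff, Nat.cast_choose ℝ (by omega), Nat.cast_choose ℝ (by omega),
      show m + (i + j) + N - (m + i) = j + N by omega,
      show m + (i + j) + N - m = i + j + N by omega, show m + i - m = i by omega,
      show i + j + N - i = j + N by omega, show m + (i + j) - (m + i) = j by omega,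
      show m + (i + j) + N - (m + (i + j)) = N by omega, show i + j - i = j by omega,
      show m + (i + j) + N + m + (e + 1) - (j + N) = 2 * m + e + 1 + i by omega,
      show m + (i + j) + N + m + (e + 1) = m + (i + j) + N + m + e + 1 by omega,
      show e + (m + (i + j)) + (m + i) = e + 2 * m + (i + j) + i by ring,
      show m + (i + j) + (m + i) = 2 * m + (i + j + i) by ring, pow_add _ (2 * m), pow_mul]
    push_cast
    field_simp
    norm_num
  have hsplit : ∑ k ∈ range (m + r + 1), projCoeff e (m + r + N) (m + r) k *
      (if m ≤ k then ((m + r + N - m).choose (k - m) : ℝ) *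
        (m + r + N + m + (e + 1)).choose (m + r + N - k) else 0) =
      ∑ i ∈ range (r + 1), projCoeff e (m + r + N) (m + r) (m + i) *
      (((m + r + N - m).choose (m + i - m) : ℝ) *
        (m + r + N + m + (e + 1)).choose (m + r + N - (m + i))) := by
    rw [add_assoc m r 1, sum_range_add, sum_eq_zero, zero_add]
    · simp
    · intro k hk
      rw [if_neg (by rw [mem_range] at hk; omega), mul_zero]
  rw [hsplit, sum_congr rfl key, ← mul_sum]
  cases r with
  | zero =>
    rw [if_pos (by simp)]
    simp only [add_zero, zero_add, sum_range_one, Nat.factorial_zero, pow_zero, Nat.sub_zero]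
    rw [show 2 * m + e + 1 = (e + 2 * m) + 1 by ring, Nat.factorial_succ (e + 2 * m)]
    push_cast
    field_simp
    ring
  | succ r =>
    rw [if_neg (by omega)]
    have h0 := sum_alternating_choose_eq_zero (r + 1) r (e + 2 * m + (r + 1)) (by omega)
    have h1 : ∀ i ∈ range (r + 1 + 1), ((-1 : ℝ) ^ (r + 1 + i) *
        (e + 2 * m + (r + 1) + i).factorial /
        ((r + 1 - i).factorial * i.factorial * (2 * m + e + 1 + i).factorial)) =
        ((-1) ^ (r + 1) * r.factorial / (r + 1).factorial) *
        ((-1 : ℝ) ^ i * (r + 1).choose i * (e + 2 * m + (r + 1) + i).choose r) := by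
      intro i hi
      rw [mem_range] at hi
      rw [Nat.cast_choose ℝ (show i ≤ r + 1 by omega), Nat.cast_choose ℝ (by omega),
        show e + 2 * m + (r + 1) + i - r = 2 * m + e + 1 + i by omega]
      field_simp
      ring
    rw [sum_congr rfl h1, ← mul_sum, h0, mul_zero, mul_zero]

theorem monicQn_zero {e N n : ℕ} (hn : n ≤ N) {α : Fin (e + 2) → ℕ} (hα : α ∈ ZN (e + 1) N)
    (x : Fin (e + 2) → ℕ) :
    monicQn (e + 1) N (fun _ => 0) α n (fun i => (x i : ℝ)) =
      ∑ k ∈ range (n + 1), projCoeff e N n k *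
        ∑ γ ∈ ZN (e + 1) k, mchoose α γ * mchoose x γ := by
  have hα' := mem_ZN.1 hα
  have h1 : ∑ β ∈ ZN (e + 1) n,
      pochV (fun i => -(α i : ℝ)) β / (mfact β * pochV (fun _ => 0 + 1) β) *
      monicQ (e + 1) N (fun _ => 0) β (fun i => (x i : ℝ)) =
      (-1) ^ n * poch (-(N : ℝ)) n / poch (((e + 1 : ℕ) : ℝ) + n) n *
        ∑ k ∈ range (n + 1), poch (((e + 1 : ℕ) : ℝ) + n) k / poch (-(N : ℝ)) k *
          ((N - k).choose (n - k) * ∑ γ ∈ ZN (e + 1) k, mchoose α γ * mchoose x γ) := by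
    have h2 : ∀ k ∈ range (n + 1), ((N - k).choose (n - k) : ℝ) *
        ∑ γ ∈ ZN (e + 1) k, mchoose α γ * mchoose x γ =
        ∑ β ∈ ZN (e + 1) n, mchoose α β * ∑ γ ∈ ZN (e + 1) k, mchoose β γ * mchoose x γ := by
      intro k hk
      simp only [mul_sum]
      rw [sum_comm]
      refine sum_congr rfl fun γ hγ => ?_
      have h := sum_mchoose_mul_of_raiseOp (n := k) (f := fun y => mchoose y γ)
        (fun y => by rw [raiseOp_mchoose, mem_ZN.1 hγ]) (k := n)
        (by rw [mem_range] at hk; omega) hn hα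
      rw [← mul_assoc, ← h, sum_mul]
      exact sum_congr rfl fun _ _ => mul_assoc _ _ _
    have h3 : ∑ k ∈ range (n + 1), poch (((e + 1 : ℕ) : ℝ) + n) k / poch (-(N : ℝ)) k *
        ((N - k).choose (n - k) * ∑ γ ∈ ZN (e + 1) k, mchoose α γ * mchoose x γ) =
        ∑ k ∈ range (n + 1), poch (((e + 1 : ℕ) : ℝ) + n) k / poch (-(N : ℝ)) k *
        ∑ β ∈ ZN (e + 1) n, mchoose α β * ∑ γ ∈ ZN (e + 1) k, mchoose β γ * mchoose x γ :=
      sum_congr rfl fun k hk => by rw [h2 k hk]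
    rw [h3]
    simp only [mul_sum]
    rw [sum_comm]
    refine sum_congr rfl fun β hβ => ?_
    rw [zero_add, monicQ_zero hβ, pochV_one, pochV_neg_natCast, mem_ZN.1 hβ]
    simp only [mul_sum]
    refine sum_congr rfl fun k _ => sum_congr rfl fun γ _ => ?_
    have := (mfact_pos β).ne'
    field_simp
  rw [monicQn, h1, mul_sum, mul_sum]
  refine sum_congr rfl fun k hk => ?_
  rw [← mul_assoc, ← mul_assoc, ← mul_assoc]
  congr 1
  simp only [sum_const_zero, zero_add, hα']
  have hk : k ≤ n := by rw [mem_range] at hk; omega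
  obtain ⟨j, rfl⟩ := Nat.exists_eq_add_of_le hk
  obtain ⟨M, rfl⟩ := Nat.exists_eq_add_of_le hn
  have e1 : ((e + 1 : ℕ) : ℝ) + (k + j : ℕ) = ((e + (k + j) : ℕ) : ℝ) + 1 := by push_cast; ring
  rw [e1, poch_natCast_add_one, poch_natCast_add_one, poch_natCast_add_one, poch_natCast_add_one]
  simp only [poch_neg_natCast, Nat.choose_self]
  rw [Nat.cast_choose ℝ (show k ≤ k + j + M by omega),
    Nat.cast_choose ℝ (show k + j ≤ k + j + M by omega),
    Nat.cast_choose ℝ (show k + j - k ≤ k + j + M - k by omega), projCoeff,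
    show k + j + M - (k + j) = M by omega, show k + j + M - k = j + M by omega,
    show k + j - k = j by omega, show j + M - j = M by omega,
    show e + 1 + 2 * (k + j) = e + (k + j) + (k + j) + 1 by ring, Nat.factorial_succ,
    show e + 1 + (k + j + M + (k + j)) = k + j + M + (k + j) + e + 1 by ring]
  have s1 := neg_one_pow_mul_self (k + j + M)
  have s2 := neg_one_pow_mul_self k
  rw [pow_add (-1 : ℝ) (k + j) k]
  generalize (-1 : ℝ) ^ (k + j + M) = u at *
  generalize (-1 : ℝ) ^ (k + j) = v at *
  generalize (-1 : ℝ) ^ k = w at *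
  push_cast
  have hw : w ≠ 0 := by rintro rfl; simp at s2
  field_simp
  linear_combination (2 * (k + j) + e + 1) * v * (s1 - s2)

/-! ### The Gram matrix -/

theorem sum_ZN_mchoose_mul_hahnG {d N k : ℕ} (hk : k ≤ N) {ν : Fin d → ℕ}
    {α : Fin (d + 1) → ℕ} (hα : α ∈ ZN d N) :
    ∑ x ∈ ZN d N, (∑ γ ∈ ZN d k, mchoose α γ * mchoose x γ) * hahnG d ν x =
      (if ∑ i, ν i ≤ k then ((N - ∑ i, ν i).choose (k - ∑ i, ν i) : ℝ) *
        (N + ∑ i, ν i + d).choose (N - k) else 0) * hahnG d ν α := by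
  set m := ∑ i, ν i with hm
  have h1 : ∑ x ∈ ZN d N, (∑ γ ∈ ZN d k, mchoose α γ * mchoose x γ) * hahnG d ν x =
      (N + m + d).choose (N - k) * ∑ γ ∈ ZN d k, mchoose α γ * hahnG d ν γ := by
    simp only [sum_mul]
    rw [sum_comm, mul_sum]
    refine sum_congr rfl fun γ hγ => ?_
    have h := sum_mchoose_mul_of_lowerOp (lowerOp_hahnG d ν) (N - k) hγ
    rw [← hm, show k + (N - k) = N by omega, ← add_assoc] at h
    simp only [mul_assoc]
    rw [← mul_sum, h]
    ring
  rw [h1]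
  split_ifs with h
  · rw [sum_mchoose_mul_of_raiseOp (raiseOp_hahnG d ν) h hk hα]
    ring
  · rw [zero_mul, sum_eq_zero, mul_zero]
    intro γ hγ
    rw [hahnG_eq_zero (by rw [mem_ZN.1 hγ]; omega), mul_zero]

theorem sum_monicQn_mul_hahnG {e N n : ℕ} (hn : n ≤ N) {α : Fin (e + 2) → ℕ}
    (hα : α ∈ ZN (e + 1) N) (ν : Fin (e + 1) → ℕ) :
    ∑ x ∈ ZN (e + 1) N,
        monicQn (e + 1) N (fun _ => 0) α n (fun i => (x i : ℝ)) * hahnG (e + 1) ν x =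
      if ∑ i, ν i = n then hahnG (e + 1) ν α else 0 := by
  simp only [monicQn_zero hn hα, sum_mul]
  rw [sum_comm]
  have h : ∀ k ∈ range (n + 1), ∑ x ∈ ZN (e + 1) N, projCoeff e N n k *
      (∑ γ ∈ ZN (e + 1) k, mchoose α γ * mchoose x γ) * hahnG (e + 1) ν x =
      projCoeff e N n k * (if ∑ i, ν i ≤ k then ((N - ∑ i, ν i).choose (k - ∑ i, ν i) : ℝ) *
        (N + ∑ i, ν i + (e + 1)).choose (N - k) else 0) * hahnG (e + 1) ν α := by
    intro k hk
    rw [mem_range] at hk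
    rw [mul_assoc (projCoeff e N n k), ← sum_ZN_mchoose_mul_hahnG (by omega) hα, mul_sum]
    exact sum_congr rfl fun x _ => mul_assoc _ _ _
  rw [sum_congr rfl h, ← sum_mul, sum_projCoeff_mul e N n _ hn, ite_mul, one_mul, zero_mul]

theorem filter_lowSet {d N n : ℕ} (hn : n ≤ N) :
    (lowSet d N).filter (fun ν => ∑ i, ν i = n) = idxSet d n := by
  ext ν
  rw [mem_filter, mem_lowSet, mem_idxSet]
  omega

/-- `monicQn` at parameter `0` is the reproducing kernel of the polynomials of degree `n`. -/
theorem monicQn_eq_sum_hahnG {e N n : ℕ} (hn : n ≤ N) {α x : Fin (e + 2) → ℕ}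
    (hα : α ∈ ZN (e + 1) N) (hx : x ∈ ZN (e + 1) N) :
    monicQn (e + 1) N (fun _ => 0) α n (fun i => (x i : ℝ)) =
      ∑ ν ∈ idxSet (e + 1) n,
        hahnG (e + 1) ν α * hahnG (e + 1) ν x / hahnC (e + 1) N ν := by
  have h1 : monicQn (e + 1) N (fun _ => 0) α n (fun i => (x i : ℝ)) =
      ∑ y ∈ ZN (e + 1) N, monicQn (e + 1) N (fun _ => 0) α n (fun i => (y i : ℝ)) *
        ∑ ν ∈ lowSet (e + 1) N,
          hahnG (e + 1) ν y * hahnG (e + 1) ν x / hahnC (e + 1) N ν := by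
    rw [sum_congr rfl fun y hy => by rw [sum_lowSet_hahnG hy hx]]
    simp [hx]
  rw [h1, ← filter_lowSet hn, sum_filter]
  simp only [mul_sum]
  rw [sum_comm]
  refine sum_congr rfl fun ν _ => ?_
  have h2 : ∀ y : Fin (e + 2) → ℕ, monicQn (e + 1) N (fun _ => 0) α n (fun i => (y i : ℝ)) *
      (hahnG (e + 1) ν y * hahnG (e + 1) ν x / hahnC (e + 1) N ν) =
      monicQn (e + 1) N (fun _ => 0) α n (fun i => (y i : ℝ)) * hahnG (e + 1) ν y *
        (hahnG (e + 1) ν x / hahnC (e + 1) N ν) := fun y => by ring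
  simp only [h2]
  rw [← sum_mul, sum_monicQn_mul_hahnG hn hα ν, ite_mul, zero_mul, mul_div_assoc]

theorem sum_monicQn_mul_monicQn {e N n : ℕ} (hn : n ≤ N) {α β : Fin (e + 2) → ℕ}
    (hα : α ∈ ZN (e + 1) N) (hβ : β ∈ ZN (e + 1) N) :
    ∑ γ ∈ ZN (e + 1) N, monicQn (e + 1) N (fun _ => 0) α n (fun i => (γ i : ℝ)) *
        monicQn (e + 1) N (fun _ => 0) β n (fun i => (γ i : ℝ)) =
      ∑ ν ∈ idxSet (e + 1) n,
        hahnG (e + 1) ν α * hahnG (e + 1) ν β / hahnC (e + 1) N ν := by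
  have h1 : ∀ γ ∈ ZN (e + 1) N, monicQn (e + 1) N (fun _ => 0) α n (fun i => (γ i : ℝ)) *
        monicQn (e + 1) N (fun _ => 0) β n (fun i => (γ i : ℝ)) =
      ∑ ν ∈ idxSet (e + 1) n, monicQn (e + 1) N (fun _ => 0) α n (fun i => (γ i : ℝ)) *
        hahnG (e + 1) ν γ * (hahnG (e + 1) ν β / hahnC (e + 1) N ν) := by
    intro γ hγ
    rw [monicQn_eq_sum_hahnG hn hβ hγ, mul_sum]
    exact sum_congr rfl fun ν _ => by ring
  rw [sum_congr rfl h1, sum_comm]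
  refine sum_congr rfl fun ν hν => ?_
  rw [mem_idxSet] at hν
  rw [← sum_mul, sum_monicQn_mul_hahnG hn hα ν, if_pos hν, mul_div_assoc]

/-! ### The Hahn polynomials `hahnH` in terms of `hahnG` -/

theorem poch_mul_hahn1_eq (n s a x y : ℕ) (g : ℝ) (hg : y < s → g = 0) :
    poch (-((x + y : ℕ) : ℝ) + s) n * hahn1 n x 0 a (((x + y : ℕ) : ℝ) - s) * g =
      (-1) ^ n * n.factorial * hahnCore n a x (y - s) * g := by
  rcases lt_or_ge y s with h | h
  · rw [hg h, mul_zero, mul_zero]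
  · obtain ⟨z, rfl⟩ := Nat.exists_eq_add_of_le h
    rw [Nat.add_sub_cancel_left,
      show -((x + (s + z) : ℕ) : ℝ) + s = -((x : ℝ) + z) by push_cast; ring,
      show ((x + (s + z) : ℕ) : ℝ) - s = (x : ℝ) + z by push_cast; ring]
    congr 1
    rcases le_or_gt n (x + z) with h1 | h1
    · exact poch_mul_hahn1 n a x z h1
    · rw [hahnCore_eq_zero a h1, mul_zero, ← Nat.cast_add, poch_neg_natCast,
        Nat.choose_eq_zero_of_lt h1]
      simp

theorem mfact_cons {m : ℕ} (n : ℕ) (μ : Fin m → ℕ) :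
    mfact (Fin.cons n μ : Fin (m + 1) → ℕ) = n.factorial * mfact μ := by
  simp [mfact, Fin.prod_univ_succ]

theorem prod_poch_mul_hahn1 (d : ℕ) (ν : Fin d → ℕ) (x : Fin (d + 1) → ℕ) :
    ∏ j : Fin d, (poch (-((∑ i, x i : ℕ) : ℝ) + sumLt d x j + sumGt d ν j) (ν j) *
        hahn1 (ν j) (x j.castSucc : ℝ) 0 (aj d (fun _ => 0) ν j)
          (((∑ i, x i : ℕ) : ℝ) - sumLt d x j - sumGt d ν j)) =
      (-1) ^ (∑ i, ν i) * mfact ν * hahnG d ν x := by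
  induction d with
  | zero => simp [mfact, hahnG]
  | succ d ih =>
    obtain ⟨a, t, rfl⟩ : ∃ a t, x = Fin.cons a t :=
      ⟨x 0, Fin.tail x, (Fin.cons_self_tail x).symm⟩
    obtain ⟨n, μ, rfl⟩ : ∃ n μ, ν = Fin.cons n μ :=
      ⟨ν 0, Fin.tail ν, (Fin.cons_self_tail ν).symm⟩
    have h1 : ∀ j : Fin d, (poch (-((a + ∑ i, t i : ℕ) : ℝ) + (a + sumLt d t j) + sumGt d μ j)
          (μ j) *
        hahn1 (μ j) (t j.castSucc : ℝ) 0 (aj d (fun _ => 0) μ j)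
          (((a + ∑ i, t i : ℕ) : ℝ) - (a + sumLt d t j) - sumGt d μ j)) =
        (poch (-((∑ i, t i : ℕ) : ℝ) + sumLt d t j + sumGt d μ j) (μ j) *
        hahn1 (μ j) (t j.castSucc : ℝ) 0 (aj d (fun _ => 0) μ j)
          (((∑ i, t i : ℕ) : ℝ) - sumLt d t j - sumGt d μ j)) := by
      intro j
      congr 2 <;> push_cast <;> ring
    have h2 := poch_mul_hahn1_eq n (∑ i, μ i) (2 * ∑ i, μ i + d) a (∑ i, t i) (hahnG d μ t)
      hahnG_eq_zero
    rw [Fin.prod_univ_succ]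
    simp only [sumLt_zero, sumGt_cons_zero, aj_cons_zero, aj_cons_succ, sumLt_cons_succ,
      sumGt_cons_succ, Fin.cons_zero, Fin.cons_succ, Fin.castSucc_zero, Fin.castSucc_succ,
      Fin.sum_cons, h1, ih, add_zero, sub_zero, hahnG_cons]
    rw [pow_add, mfact_cons]
    linear_combination (-1) ^ (∑ i, μ i) * mfact μ * h2

theorem hahnH_eq {d N : ℕ} (ν : Fin d → ℕ) {x : Fin (d + 1) → ℕ} (hx : x ∈ ZN d N) :
    hahnH d N (fun _ => 0) ν x =
      1 / poch (-(N : ℝ)) (∑ i, ν i) *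
        (∏ j, ((ν j).factorial : ℝ) ^ 2 / poch (aj d (fun _ => 0) ν j + 1) (ν j)) *
        hahnG d ν x := by
  have h := prod_poch_mul_hahn1 d ν x
  rw [mem_ZN.1 hx] at h
  rw [hahnH]
  simp only [zero_add, poch_one]
  have h1 : ∏ j : Fin d, ((ν j).factorial / poch (aj d (fun _ => 0) ν j + 1) (ν j) *
      poch (-(N : ℝ) + sumLt d x j + sumGt d ν j) (ν j) *
      hahn1 (ν j) (x j.castSucc : ℝ) 0 (aj d (fun _ => 0) ν j)
          ((N : ℝ) - sumLt d x j - sumGt d ν j)) =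
      (∏ j, ((ν j).factorial : ℝ) / poch (aj d (fun _ => 0) ν j + 1) (ν j)) *
      ((-1) ^ (∑ i, ν i) * mfact ν * hahnG d ν x) := by
    rw [← h, ← prod_mul_distrib]
    exact prod_congr rfl fun j _ => mul_assoc _ _ _
  have h2 : (∏ j, ((ν j).factorial : ℝ) / poch (aj d (fun _ => 0) ν j + 1) (ν j)) * mfact ν =
      ∏ j, ((ν j).factorial : ℝ) ^ 2 / poch (aj d (fun _ => 0) ν j + 1) (ν j) := by
    rw [mfact, ← prod_mul_distrib]
    exact prod_congr rfl fun j _ => by ring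
  have h3 := neg_one_pow_mul_self (∑ i, ν i)
  rw [h1, ← h2]
  linear_combination (∏ j, ((ν j).factorial : ℝ) / poch (aj d (fun _ => 0) ν j + 1) (ν j)) *
    mfact ν * hahnG d ν x / poch (-(N : ℝ)) (∑ i, ν i) * h3

theorem hahnH_mul_div_Bnorm {d N : ℕ} {ν : Fin d → ℕ} (hν : ∑ i, ν i ≤ N)
    {x y : Fin (d + 1) → ℕ} (hx : x ∈ ZN d N) (hy : y ∈ ZN d N) :
    1 / ((N + d).choose d : ℝ) *
        (hahnH d N (fun _ => 0) ν x * hahnH d N (fun _ => 0) ν y / Bnorm d N (fun _ => 0) ν) =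
      hahnG d ν x * hahnG d ν y / hahnC d N ν := by
  have hprod : (∏ j, ((ν j).factorial : ℝ) ^ 2 / poch (aj d (fun _ => 0) ν j + 1) (ν j)) ^ 2 *
      hahnA d ν = ∏ j, poch (aj d (fun _ => 0) ν j + 1) (2 * ν j) * ((ν j).factorial : ℝ) *
        ((ν j).factorial : ℝ) /
        (poch (aj d (fun _ => 0) ν j + 1) (ν j) * poch (aj d (fun _ => 0) ν j + 1) (ν j)) := by
    rw [hahnA, ← prod_pow, ← prod_mul_distrib]
    refine prod_congr rfl fun j _ => ?_
    have := (poch_aj_pos d ν j (ν j)).ne'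
    field_simp
  have hK : (∏ j, ((ν j).factorial : ℝ) ^ 2 / poch (aj d (fun _ => 0) ν j + 1) (ν j)) ≠ 0 :=
    (prod_pos fun j _ => div_pos (by positivity) (poch_aj_pos d ν j _)).ne'
  have hA := (hahnA_pos d ν).ne'
  rw [hahnH_eq ν hx, hahnH_eq ν hy, Bnorm, hahnC]
  simp only [zero_add, sum_const_zero, poch_one]
  rw [← hprod]
  generalize (∏ j, ((ν j).factorial : ℝ) ^ 2 / poch (aj d (fun _ => 0) ν j + 1) (ν j)) = K at *
  generalize hahnA d ν = A at *
  generalize ∑ i, ν i = n at *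
  obtain ⟨M, rfl⟩ := Nat.exists_eq_add_of_le hν
  simp only [poch_natCast_add_one, poch_neg_natCast]
  rw [Nat.cast_choose ℝ (show n ≤ n + M by omega),
    Nat.cast_choose ℝ (show d ≤ n + M + d by omega),
    Nat.cast_choose ℝ (show 2 * n + d ≤ n + M + n + d by omega),
    show n + M - n = M by omega, show n + M + d - d = n + M by omega,
    show n + M + n + d - (2 * n + d) = M by omega, show n + M + n + d = d + (n + M + n) by ring,
    show 2 * n + d = d + 2 * n by ring, show n + M + d = d + (n + M) by ring]
  have hs := neg_one_pow_mul_self n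
  have hs0 : (-1 : ℝ) ^ n ≠ 0 := by simp
  generalize (-1 : ℝ) ^ n = s at *
  field_simp
  linear_combination -hahnG d ν x * hahnG d ν y * hs

/-- the Gram matrix of the vectors `q_{α,n}` (κ = 0) is the reproducing
kernel divided by `C(N+d, d)`. -/
theorem monicQn_gram_eq_kernel (d N n : ℕ) (hd : 1 ≤ d) (hN : 1 ≤ N) (h1 : 1 ≤ n)
    (hn : n ≤ N) (α β : Fin (d + 1) → ℕ) (hα : α ∈ ZN d N) (hβ : β ∈ ZN d N) :
    ∑ γ ∈ ZN d N,
        monicQn d N (fun _ => 0) α n (fun i => (γ i : ℝ)) *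
          monicQn d N (fun _ => 0) β n (fun i => (γ i : ℝ)) =
      1 / (Nat.choose (N + d) d : ℝ) *
        ∑ ν ∈ idxSet d n,
          hahnH d N (fun _ => 0) ν α * hahnH d N (fun _ => 0) ν β /
            Bnorm d N (fun _ => 0) ν := by
  obtain ⟨e, rfl⟩ := Nat.exists_eq_add_of_le' hd
  rw [sum_monicQn_mul_monicQn hn hα hβ, mul_sum]
  refine sum_congr rfl fun ν hν => ?_
  rw [mem_idxSet] at hν
  exact (hahnH_mul_div_Bnorm (hν.trans_le hn) hα hβ).symm
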